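/- Pressure estimate: For any σ with −1 < σ ≤ 1 there exists a constant C such that if u and v are divergence-free vector fields on 𝕋^d, then ‖∇(−Δ)^{−1} div(u·∇v)‖_{B^σ_{∞,1}} ≤ C · min( ‖u‖_{B^σ_{∞,1}} ‖v‖_{B^1_{∞,1}}, ‖u‖_{B^1_{∞,1}} ‖v‖_{B^σ_{∞,1}} ). -/

import Mathlib

open MeasureTheory Complex
open scoped BigOperators ENNReal NNReal

noncomputable section

/-! ## A Fourier-analytic framework for distributions on the torus `𝕋^d`

A distribution on `𝕋^d` is represented by its sequence of Fourier coefficients,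
a function `(Fin d → ℤ) → E` (with `E = ℂ` for scalar functions, `E = Fin d → ℂ`
for vector fields, etc.).  All operators (Littlewood–Paley blocks, Leray
projection, advection, Laplacian, ...) are defined on the Fourier side, and `L^p`
norms are computed from the realization as a (periodic) function on the cube. -/

/-- Euclidean norm of a lattice frequency. -/
def znorm {d : ℕ} (k : Fin d → ℤ) : ℝ := Real.sqrt (∑ i, ((k i : ℝ)) ^ 2)

/-- Squared Euclidean norm of a lattice frequency. -/
def znorm2 {d : ℕ} (k : Fin d → ℤ) : ℤ := ∑ i, (k i) ^ 2

/-- The character `e^{2πik·x}`. -/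
def fChar {d : ℕ} (k : Fin d → ℤ) (x : Fin d → ℝ) : ℂ :=
  Complex.exp (((2 * Real.pi * ∑ i, (k i : ℝ) * x i : ℝ) : ℂ) * Complex.I)

variable {d : ℕ} {E : Type*}

/-- Realization of a Fourier coefficient sequence as a (periodic) function on `ℝ^d`. -/
def realize [NormedAddCommGroup E] [NormedSpace ℂ E] (a : (Fin d → ℤ) → E) :
    (Fin d → ℝ) → E :=
  fun x => ∑' k, fChar k x • a k

/-- The fundamental cube of the torus, as a measure on `ℝ^d`. -/
def μT (d : ℕ) : Measure (Fin d → ℝ) := volume.restrict (Set.Icc 0 1)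

/-- The `L^p` norm over the torus of (the realization of) a coefficient sequence. -/
def tLp [NormedAddCommGroup E] [NormedSpace ℂ E] (p : ℝ≥0∞) (a : (Fin d → ℤ) → E) :
    ℝ≥0∞ :=
  eLpNorm (realize a) p (μT d)

/-- A smooth monotone Littlewood–Paley cutoff function `χ` as in the paper:
`χ : [0,∞) → [0,1]`, `χ ≡ 1` on `[0,1/2]`, `χ(3/4) = 1/2`, `χ ≡ 0` on `[1,∞)`. -/
structure Cutoff where
  χ : ℝ → ℝ
  smooth : ContDiff ℝ (⊤ : ℕ∞) χ
  mono : AntitoneOn χ (Set.Ici 0)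
  nonneg : ∀ x, 0 ≤ χ x
  le_one : ∀ x, χ x ≤ 1
  eq_one : ∀ x ∈ Set.Icc (0 : ℝ) (1 / 2), χ x = 1
  eq_half : χ (3 / 4) = 1 / 2
  eq_zero : ∀ x, (1 : ℝ) ≤ x → χ x = 0

/-- The symbol of the Littlewood–Paley block `Δ_j`:
`χ(t)` for `j = 0` and `φ(t/2^j) = χ(t/2^j) − χ(t/2^{j-1})` for `j ≥ 1`. -/
def lpSymb (c : Cutoff) : ℕ → ℝ → ℝ
  | 0, t => c.χ t
  | j + 1, t => c.χ (t / 2 ^ (j + 1)) - c.χ (t / 2 ^ j)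

/-- The Littlewood–Paley block `Δ_j`, acting on Fourier coefficients. -/
def blockC [NormedAddCommGroup E] [NormedSpace ℂ E] (c : Cutoff) (j : ℕ)
    (a : (Fin d → ℤ) → E) : (Fin d → ℤ) → E :=
  fun k => ((lpSymb c j (znorm k) : ℝ) : ℂ) • a k

/-- The low-frequency cutoff `S_j = Δ_0 + Δ_1 + ⋯ + Δ_j`, acting on Fourier coefficients. -/
def lowC [NormedAddCommGroup E] [NormedSpace ℂ E] (c : Cutoff) (j : ℕ)
    (a : (Fin d → ℤ) → E) : (Fin d → ℤ) → E :=
  fun k => ((∑ l ∈ Finset.range (j + 1), lpSymb c l (znorm k) : ℝ) : ℂ) • a k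

/-- The `ℓ^r` norm (`r ∈ [1,∞]`) of a sequence of extended nonnegative reals. -/
def lr (r : ℝ≥0∞) (a : ℕ → ℝ≥0∞) : ℝ≥0∞ :=
  if r = ∞ then ⨆ j, a j else (∑' j, a j ^ r.toReal) ^ (1 / r.toReal)

/-- The inhomogeneous Besov norm `‖·‖_{B^s_{p,r}}` on the torus:
the `ℓ^r` norm of `j ↦ 2^{js} ‖Δ_j a‖_{L^p}`. -/
def besov [NormedAddCommGroup E] [NormedSpace ℂ E] (c : Cutoff) (s : ℝ) (p r : ℝ≥0∞)
    (a : (Fin d → ℤ) → E) : ℝ≥0∞ :=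
  lr r fun j => (2 : ℝ≥0∞) ^ ((j : ℝ) * s) * tLp p (blockC c j a)

/-- Rapid decay of Fourier coefficients: the represented distribution is smooth. -/
def SmoothCoeff [NormedAddCommGroup E] (a : (Fin d → ℤ) → E) : Prop :=
  ∀ n : ℕ, ∃ C : ℝ, ∀ k, ‖a k‖ * (1 + znorm k) ^ n ≤ C

/-- The Fourier multiplier `Λ^s = (-Δ)^{s/2}` with symbol `|k|^s`. -/
def lambdaPow [NormedAddCommGroup E] [NormedSpace ℂ E] (s : ℝ) (a : (Fin d → ℤ) → E) :
    (Fin d → ℤ) → E :=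
  fun k => ((znorm k ^ s : ℝ) : ℂ) • a k

/-- Fourier coefficients of the pointwise product of a scalar function with
coefficients `a` and an `E`-valued function with coefficients `b` (convolution). -/
def convC [NormedAddCommGroup E] [NormedSpace ℂ E] (a : (Fin d → ℤ) → ℂ)
    (b : (Fin d → ℤ) → E) : (Fin d → ℤ) → E :=
  fun k => ∑' m, a m • b (k - m)

/-- The Bony paraproduct `T_u v = Σ_{j≥1} S_{j−1}u Δ_j v`, on Fourier coefficients. -/
def para (c : Cutoff) (u v : (Fin d → ℤ) → ℂ) : (Fin d → ℤ) → ℂ :=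
  fun k => ∑' j : ℕ, convC (lowC c j u) (blockC c (j + 1) v) k

/-- The Bony remainder `R(u,v) = Σ_{|j−l|≤1} Δ_j u Δ_l v`, on Fourier coefficients. -/
def remainder (c : Cutoff) (u v : (Fin d → ℤ) → ℂ) : (Fin d → ℤ) → ℂ :=
  fun k => ∑' j : ℕ, ∑' l : ℕ,
    if ((j : ℤ) - l).natAbs ≤ 1 then convC (blockC c j u) (blockC c l v) k else 0

/-- Fourier coefficients of a vector field on `𝕋^d`. -/
abbrev VC (d : ℕ) := (Fin d → ℤ) → Fin d → ℂ

/-- The divergence-free condition `∇·u = 0`, on Fourier coefficients. -/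
def DivFree {d : ℕ} (u : VC d) : Prop := ∀ k, ∑ i, (k i : ℂ) * u k i = 0

/-- Fourier coefficients of the advection term `u·∇v = Σ_l u_l ∂_l v`. -/
def advect {d : ℕ} (u v : VC d) : VC d :=
  fun k i => ∑' m : Fin d → ℤ,
    (∑ l, u m l * (((2 * Real.pi : ℝ) : ℂ) * Complex.I * ((k l - m l : ℤ) : ℂ)))
      * v (k - m) i

/-- The Leray projection `ℙ` onto divergence-free fields, on Fourier coefficients. -/
def leray {d : ℕ} (v : VC d) : VC d :=
  fun k i => if k = 0 then v k i
    else v k i - ((∑ l, (k l : ℂ) * v k l) / ((znorm2 k : ℤ) : ℂ)) * (k i : ℂ)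

/-- Fourier coefficients of the Laplacian `Δ`. -/
def lapC [NormedAddCommGroup E] [NormedSpace ℂ E] (a : (Fin d → ℤ) → E) :
    (Fin d → ℤ) → E :=
  fun k => ((-(4 * Real.pi ^ 2 * ((znorm2 k : ℤ) : ℝ)) : ℝ) : ℂ) • a k

/-- Fourier coefficients of the gradient `∇q` of a scalar function. -/
def gradC {d : ℕ} (q : (Fin d → ℤ) → ℂ) : VC d :=
  fun k i => ((2 * Real.pi : ℝ) : ℂ) * Complex.I * ((k i : ℤ) : ℂ) * q k

/-- Fourier coefficients of the full gradient `∇u` (a matrix field) of a vector field. -/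
def gradM {d : ℕ} (u : VC d) : (Fin d → ℤ) → Fin d → Fin d → ℂ :=
  fun k i l => ((2 * Real.pi : ℝ) : ℂ) * Complex.I * ((k l : ℤ) : ℂ) * u k i

/-- Fourier coefficients of the divergence `∇·w` of a vector field. -/
def divC {d : ℕ} (w : VC d) : (Fin d → ℤ) → ℂ :=
  fun k => ((2 * Real.pi : ℝ) : ℂ) * Complex.I * ∑ l, (k l : ℂ) * w k l

/-- The inverse `(−Δ)^{−1}` of the negative Laplacian on mean-zero functions. -/
def invNegLap [NormedAddCommGroup E] [NormedSpace ℂ E] (a : (Fin d → ℤ) → E) :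
    (Fin d → ℤ) → E :=
  fun k => if k = 0 then 0 else (((4 * Real.pi ^ 2 * ((znorm2 k : ℤ) : ℝ))⁻¹ : ℝ) : ℂ) • a k

/-- The commutator `I_j = [u·∇, ℙΔ_j] f = u·∇(ℙΔ_j f) − ℙΔ_j (u·∇ f)`. -/
def commJ {d : ℕ} (c : Cutoff) (u f : VC d) (j : ℕ) : VC d :=
  fun k i => advect u (leray (blockC c j f)) k i - leray (blockC c j (advect u f)) k i

/-- `U` (with pressure `P`) solves the incompressible Navier–Stokes equations
`∂_t u + u·∇u + ∇p = νΔu`, `∇·u = 0` on the time interval `[0,T]`, on the Fourier side. -/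
def SolvesNS (ν T : ℝ) (U : ℝ → VC 2) (P : ℝ → (Fin 2 → ℤ) → ℂ) : Prop :=
  (∀ t ∈ Set.Icc (0 : ℝ) T, DivFree (U t)) ∧
  ∀ t ∈ Set.Icc (0 : ℝ) T, ∀ k i,
    HasDerivAt (fun s => U s k i)
      ((ν : ℂ) * lapC (U t) k i - advect (U t) (U t) k i - gradC (P t) k i) t

/-- One step of the semi-implicit scheme
`(u^{n+1} − u^n)/τ + ℙ(u^n·∇u^{n+1}) = νΔu^{n+1}`. -/
def SchemeStep (ν τ : ℝ) (v w : VC 2) : Prop :=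
  ∀ k i, (w k i - v k i) / (τ : ℂ) + leray (advect v w) k i = (ν : ℂ) * lapC w k i

open scoped Classical in
/-- The Fourier truncation `Π_N`, keeping only the frequencies with `1 ≤ |k|_∞ ≤ N`. -/
def truncC {d : ℕ} (N : ℕ) (v : VC d) : VC d :=
  fun k i => if (∀ l, |k l| ≤ (N : ℤ)) ∧ k ≠ 0 then v k i else 0

/-- One step of the fully discrete Fourier spectral semi-implicit scheme
`(u^{n+1} − u^n)/τ + ℙΠ_N(u^n·∇u^{n+1}) = νΔu^{n+1}`. -/
def SchemeStepN (N : ℕ) (ν τ : ℝ) (v w : VC 2) : Prop :=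
  ∀ k i, (w k i - v k i) / (τ : ℂ) + leray (truncC N (advect v w)) k i
    = (ν : ℂ) * lapC w k i


/-! ### Trigonometric polynomials -/

lemma eq_zero_of_notMem_toFinset [Zero E] {a : (Fin d → ℤ) → E}
    (ha : (Function.support a).Finite) : ∀ k ∉ ha.toFinset, a k = 0 := fun k hk => by
  simpa using hk

section TrigPoly

variable [NormedAddCommGroup E] [NormedSpace ℂ E]

lemma fChar_add (k : Fin d → ℤ) (x y : Fin d → ℝ) :
    fChar k (x + y) = fChar k x * fChar k y := by
  simp only [fChar, ← Complex.exp_add, Pi.add_apply, mul_add, Finset.sum_add_distrib]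
  congr 1
  push_cast
  ring

lemma fChar_freq_add (k l : Fin d → ℤ) (x : Fin d → ℝ) :
    fChar (k + l) x = fChar k x * fChar l x := by
  simp only [fChar, ← Complex.exp_add, Pi.add_apply, Int.cast_add, add_mul,
    Finset.sum_add_distrib]
  congr 1
  push_cast
  ring

lemma norm_fChar (k : Fin d → ℤ) (x : Fin d → ℝ) : ‖fChar k x‖ = 1 :=
  Complex.norm_exp_ofReal_mul_I _

lemma continuous_fChar (k : Fin d → ℤ) : Continuous (fChar k) := by
  unfold fChar
  fun_prop

lemma fChar_intCast (k l : Fin d → ℤ) : fChar k (fun i => (l i : ℝ)) = 1 := by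
  rw [fChar, Complex.exp_eq_one_iff]
  refine ⟨∑ i, k i * l i, ?_⟩
  push_cast
  ring

lemma mFourier_coe (k : Fin d → ℤ) (x : Fin d → ℝ) :
    UnitAddTorus.mFourier k (fun i => (x i : UnitAddCircle)) = fChar k x := by
  simp only [UnitAddTorus.mFourier, ContinuousMap.coe_mk, fourier_coe_apply, fChar,
    ← Complex.exp_sum]
  congr 1
  push_cast
  rw [Finset.mul_sum, Finset.sum_mul]
  exact Finset.sum_congr rfl fun i _ => by simp; ring

lemma realize_eq_sum {a : (Fin d → ℤ) → E} {s : Finset (Fin d → ℤ)}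
    (hs : ∀ k ∉ s, a k = 0) (x : Fin d → ℝ) :
    realize a x = ∑ k ∈ s, fChar k x • a k :=
  tsum_eq_sum fun k hk => by rw [hs k hk, smul_zero]

lemma continuous_realize {a : (Fin d → ℤ) → E} (ha : (Function.support a).Finite) :
    Continuous (realize a) := by
  rw [funext (realize_eq_sum (eq_zero_of_notMem_toFinset ha))]
  exact continuous_finsetSum _ fun k _ => (continuous_fChar k).smul continuous_const

lemma realize_add_intCast (a : (Fin d → ℤ) → E) (x : Fin d → ℝ) (l : Fin d → ℤ) :
    realize a (x + fun i => (l i : ℝ)) = realize a x := by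
  simp only [realize, fChar_add, fChar_intCast, mul_one]

lemma tLp_top_le {a : (Fin d → ℤ) → E} {M : ℝ≥0∞} (h : ∀ x, ‖realize a x‖ₑ ≤ M) :
    tLp ∞ a ≤ M := by
  rw [tLp, eLpNorm_exponent_top]
  exact eLpNormEssSup_le_of_ae_enorm_bound (ae_of_all _ h)

/-- The essential supremum over the unit cube bounds a trigonometric polynomial everywhere. -/
lemma enorm_realize_le_tLp {a : (Fin d → ℤ) → E} (ha : (Function.support a).Finite)
    (x : Fin d → ℝ) : ‖realize a x‖ₑ ≤ tLp ∞ a := by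
  have hcont := continuous_realize ha
  have hae : ∀ᵐ y ∂(μT d), ‖realize a y‖ₑ ≤ tLp ∞ a := by
    rw [tLp, eLpNorm_exponent_top]
    exact ae_le_eLpNormEssSup
  have hclosed : IsClosed {y | ‖realize a y‖ₑ ≤ tLp ∞ a} :=
    isClosed_le hcont.enorm continuous_const
  have hinterior : Set.univ.pi (fun _ : Fin d => Set.Ioo (0 : ℝ) 1) ⊆
      {y | ‖realize a y‖ₑ ≤ tLp ∞ a} := by
    have hopen : IsOpen (Set.univ.pi (fun _ : Fin d => Set.Ioo (0 : ℝ) 1)) :=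
      isOpen_set_pi Set.finite_univ fun _ _ => isOpen_Ioo
    have hsub : Set.univ.pi (fun _ : Fin d => Set.Ioo (0 : ℝ) 1) ⊆ Set.Icc 0 1 := fun y hy =>
      ⟨fun i => (hy i trivial).1.le, fun i => (hy i trivial).2.le⟩
    by_contra hne
    obtain ⟨y, hy, hy'⟩ := Set.not_subset.mp hne
    have hU : IsOpen (Set.univ.pi (fun _ : Fin d => Set.Ioo (0 : ℝ) 1) ∩
        {y | ‖realize a y‖ₑ ≤ tLp ∞ a}ᶜ) := hopen.inter hclosed.isOpen_compl
    have hpos := hU.measure_pos volume ⟨y, hy, hy'⟩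
    have hzero : μT d {y | ‖realize a y‖ₑ ≤ tLp ∞ a}ᶜ = 0 := hae
    rw [μT, Measure.restrict_apply hclosed.isOpen_compl.measurableSet] at hzero
    refine hpos.ne' (measure_mono_null ?_ hzero)
    exact fun z hz => ⟨hz.2, hsub hz.1⟩
  have hcube : Set.univ.pi (fun _ : Fin d => Set.Icc (0 : ℝ) 1) ⊆
      {y | ‖realize a y‖ₑ ≤ tLp ∞ a} := by
    have := closure_minimal hinterior hclosed
    rwa [closure_pi_set, closure_Ioo zero_ne_one] at this
  have hx : realize a x = realize a (fun i => Int.fract (x i)) := by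
    rw [← realize_add_intCast a (fun i => Int.fract (x i)) (fun i => ⌊x i⌋)]
    congr 1
    funext i
    exact (Int.fract_add_floor (x i)).symm
  rw [hx]
  exact hcube fun i _ => ⟨Int.fract_nonneg _, (Int.fract_lt_one _).le⟩

end TrigPoly

local instance : MeasureSpace UnitAddCircle := ⟨AddCircle.haarAddCircle⟩

local instance : IsProbabilityMeasure (volume : Measure UnitAddCircle) :=
  inferInstanceAs (IsProbabilityMeasure AddCircle.haarAddCircle)

/-- Bessel's inequality for trigonometric polynomials. -/
lemma sum_sq_norm_coeff_le {a : (Fin d → ℤ) → ℂ} (ha : (Function.support a).Finite) {A : ℝ}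
    (hA : 0 ≤ A) (hbd : ∀ x, ‖realize a x‖ ≤ A) (s : Finset (Fin d → ℤ)) :
    ∑ k ∈ s, ‖a k‖ ^ 2 ≤ A ^ 2 := by
  classical
  set t := s ∪ ha.toFinset with ht
  have hat : ∀ k ∉ t, a k = 0 := fun k hk =>
    eq_zero_of_notMem_toFinset ha k fun h => hk (Finset.mem_union_right _ h)
  set f : C(UnitAddTorus (Fin d), ℂ) := ∑ k ∈ t, a k • UnitAddTorus.mFourier k with hf
  have hfn : ‖f‖ ≤ A := by
    refine (ContinuousMap.norm_le _ hA).mpr fun y => ?_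
    obtain ⟨x, rfl⟩ : ∃ x : Fin d → ℝ, (fun i => (x i : UnitAddCircle)) = y :=
      ⟨fun i => (y i).out, funext fun i => Quotient.out_eq (y i)⟩
    have : f (fun i => (x i : UnitAddCircle)) = realize a x := by
      rw [realize_eq_sum hat, hf, ContinuousMap.coe_sum, Finset.sum_apply]
      refine Finset.sum_congr rfl fun k _ => ?_
      rw [ContinuousMap.coe_smul, Pi.smul_apply, mFourier_coe, smul_eq_mul, smul_eq_mul, mul_comm]
    rw [this]
    exact hbd x
  have hL : ‖ContinuousMap.toLp (E := ℂ) 2 (volume : Measure (UnitAddTorus (Fin d))) ℂ f‖ ≤ A := by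
    refine (Lp.norm_le_of_ae_bound hA (C := A) ?_).trans ?_
    · filter_upwards [ContinuousMap.coeFn_toLp (p := 2) (𝕜 := ℂ)
        (volume : Measure (UnitAddTorus (Fin d))) f] with y hy
      rw [hy]
      exact (f.norm_coe_le_norm y).trans hfn
    · simp [measureUnivNNReal]
  have horth := UnitAddTorus.orthonormal_mFourier (d := Fin d)
  have hsum : ContinuousMap.toLp (E := ℂ) 2 (volume : Measure (UnitAddTorus (Fin d))) ℂ f =
      ∑ k ∈ t, a k • UnitAddTorus.mFourierLp 2 k := by
    rw [hf, map_sum]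
    simp only [map_smul]
  have hsq : ‖ContinuousMap.toLp (E := ℂ) 2 (volume : Measure (UnitAddTorus (Fin d))) ℂ f‖ ^ 2 =
      ∑ k ∈ t, ‖a k‖ ^ 2 := by
    have h1 := horth.inner_sum a a t
    rw [← hsum, inner_self_eq_norm_sq_to_K] at h1
    have h2 : ((∑ k ∈ t, ‖a k‖ ^ 2 : ℝ) : ℂ) = ∑ k ∈ t, (starRingEnd ℂ) (a k) * a k := by
      push_cast
      refine Finset.sum_congr rfl fun k _ => ?_
      rw [mul_comm, Complex.mul_conj, Complex.normSq_eq_norm_sq, Complex.ofReal_pow]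
    rw [← h2] at h1
    exact Complex.ofReal_injective (by rw [Complex.ofReal_pow]; exact h1)
  calc ∑ k ∈ s, ‖a k‖ ^ 2 ≤ ∑ k ∈ t, ‖a k‖ ^ 2 :=
        Finset.sum_le_sum_of_subset_of_nonneg Finset.subset_union_left fun _ _ _ => sq_nonneg _
    _ ≤ A ^ 2 := by rw [← hsq]; gcongr

/-! ### Fourier multipliers with smooth compactly supported symbols -/

/-- A lattice frequency as a point of Euclidean space. -/
def latticePt (k : Fin d → ℤ) : EuclideanSpace ℝ (Fin d) := WithLp.toLp 2 fun i => (k i : ℝ)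

@[simp] lemma latticePt_apply (k : Fin d → ℤ) (i : Fin d) : latticePt k i = k i := rfl

lemma znorm_eq_norm (k : Fin d → ℤ) : znorm k = ‖latticePt k‖ := by
  simp [znorm, EuclideanSpace.norm_eq]

lemma latticePt_add (k l : Fin d → ℤ) : latticePt (k + l) = latticePt k + latticePt l := by
  ext i
  simp

lemma znorm_add_le (k l : Fin d → ℤ) : znorm (k + l) ≤ znorm k + znorm l := by
  simp only [znorm_eq_norm, latticePt_add]
  exact norm_add_le _ _

lemma znorm_nonneg (k : Fin d → ℤ) : 0 ≤ znorm k := Real.sqrt_nonneg _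

lemma znorm_neg (k : Fin d → ℤ) : znorm (-k) = znorm k := by simp [znorm]

lemma abs_apply_le_znorm (k : Fin d → ℤ) (i : Fin d) : |(k i : ℝ)| ≤ znorm k := by
  rw [znorm_eq_norm]
  exact PiLp.norm_apply_le (latticePt k) i

lemma znorm_sq (k : Fin d → ℤ) : znorm k ^ 2 = (znorm2 k : ℝ) := by
  rw [znorm, Real.sq_sqrt (Finset.sum_nonneg fun _ _ => sq_nonneg _), znorm2]
  push_cast
  rfl

lemma finite_znorm_lt (R : ℝ) : {k : Fin d → ℤ | znorm k < R}.Finite := by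
  refine (Set.finite_Icc (fun _ : Fin d => -⌈R⌉) (fun _ => ⌈R⌉)).subset fun k hk => ?_
  have h : ∀ i, |k i| ≤ ⌈R⌉ := fun i => by
    have h1 : |(k i : ℝ)| ≤ ⌈R⌉ :=
      (abs_apply_le_znorm k i).trans ((le_of_lt hk).trans (Int.le_ceil R))
    exact_mod_cast h1
  exact ⟨fun i => (abs_le.mp (h i)).1, fun i => (abs_le.mp (h i)).2⟩

lemma fChar_sub_smul (k : Fin d → ℤ) (x : Fin d → ℝ) (t : ℝ) (y : EuclideanSpace ℝ (Fin d)) :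
    fChar k (x + fun i => -(t * y i)) =
      fChar k x * Complex.exp (((-2 * Real.pi * inner ℝ y (t • latticePt k) : ℝ) : ℂ) *
        Complex.I) := by
  rw [fChar_add]
  congr 1
  rw [fChar, PiLp.inner_apply, Finset.mul_sum, Finset.mul_sum]
  congr 3
  refine Finset.sum_congr rfl fun i _ => ?_
  simp
  ring

/-- A dilated multiplier whose symbol is smooth with compact support is bounded on `L^∞`,
uniformly in the dilation. -/
lemma exists_multiplier_bound {ψ : EuclideanSpace ℝ (Fin d) → ℂ}
    (hψ : ContDiff ℝ (⊤ : ℕ∞) ψ) (hc : HasCompactSupport ψ) :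
    ∃ C : ℝ, 0 ≤ C ∧ ∀ (t : ℝ) (f : (Fin d → ℤ) → ℂ), (Function.support f).Finite →
      ∀ A : ℝ, (∀ x, ‖realize f x‖ ≤ A) →
        ∀ x, ‖realize (fun k => ψ (t • latticePt k) * f k) x‖ ≤ C * A := by
  set Ψ := hc.toSchwartzMap hψ with hΨ
  set g : SchwartzMap (EuclideanSpace ℝ (Fin d)) ℂ := FourierTransformInv.fourierInv Ψ with hg
  have hfg : ∀ ξ, ψ ξ =
      ∫ y, Complex.exp (((-2 * Real.pi * inner ℝ y ξ : ℝ) : ℂ) * Complex.I) • g y := fun ξ => by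
    rw [← Real.fourier_eq', ← SchwartzMap.fourier_coe, hg, FourierTransform.fourier_fourierInv_eq]
    rfl
  have hgi : Integrable (fun y => g y) := g.integrable
  refine ⟨∫ y, ‖g y‖, integral_nonneg fun _ => norm_nonneg _, fun t f hf A hA x => ?_⟩
  have hexp : ∀ k : Fin d → ℤ, Integrable fun y : EuclideanSpace ℝ (Fin d) =>
      fChar k (x + fun i => -(t * y i)) * f k * g y := fun k => by
    refine hgi.bdd_mul (c := ‖f k‖) ?_ (ae_of_all _ fun y => ?_)
    · refine Continuous.aestronglyMeasurable ?_
      refine ((continuous_fChar k).comp ?_).mul continuous_const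
      fun_prop
    · rw [norm_mul, norm_fChar, one_mul]
  have hrep : realize (fun k => ψ (t • latticePt k) * f k) x =
      ∫ y, realize f (x + fun i => -(t * y i)) * g y := by
    have hs := eq_zero_of_notMem_toFinset hf
    rw [realize_eq_sum (s := hf.toFinset) fun k hk => by rw [hs k hk, mul_zero]]
    simp only [realize_eq_sum hs, Finset.sum_mul, smul_eq_mul]
    rw [integral_finsetSum _ fun k _ => hexp k]
    refine Finset.sum_congr rfl fun k _ => ?_
    rw [hfg, ← mul_assoc, mul_comm (fChar k x), mul_assoc, mul_comm, ← integral_const_mul]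
    refine integral_congr_ae (ae_of_all _ fun y => ?_)
    simp only [fChar_sub_smul, smul_eq_mul]
    ring
  rw [hrep, ← integral_mul_const]
  refine norm_integral_le_of_norm_le (hgi.norm.mul_const A) (ae_of_all _ fun y => ?_)
  rw [norm_mul, mul_comm]
  exact mul_le_mul_of_nonneg_left (hA _) (norm_nonneg _)

/-- The symbol of the operator `D_i Δ⁻¹`, localized to a dyadic annulus of unit size. -/
def annSymb (c : Cutoff) (i : Fin d) (ξ : EuclideanSpace ℝ (Fin d)) : ℂ :=
  (((c.χ ‖ξ‖ - c.χ (2 * ‖ξ‖)) * (ξ i / ‖ξ‖ ^ 2) : ℝ) : ℂ)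

/-- The symbol of the derivative `D_i`, localized to a ball. -/
def ballSymb (c : Cutoff) (i : Fin d) (ξ : EuclideanSpace ℝ (Fin d)) : ℂ :=
  ((c.χ (‖ξ‖ / 2) * ξ i : ℝ) : ℂ)

lemma contDiff_cutoff_norm (c : Cutoff) (t : ℝ) (ht : 0 < t) :
    ContDiff ℝ (⊤ : ℕ∞) fun ξ : EuclideanSpace ℝ (Fin d) => c.χ (t * ‖ξ‖) := by
  rw [contDiff_iff_contDiffAt]
  intro ξ
  by_cases hξ : ξ = 0
  · have : (fun ξ : EuclideanSpace ℝ (Fin d) => c.χ (t * ‖ξ‖)) =ᶠ[nhds ξ] fun _ => 1 := by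
      have hn : ∀ᶠ η : EuclideanSpace ℝ (Fin d) in nhds ξ, t * ‖η‖ < 1 / 2 := by
        refine Filter.Tendsto.eventually_lt_const (v := 0) (by norm_num) ?_
        have : Continuous fun η : EuclideanSpace ℝ (Fin d) => t * ‖η‖ := by fun_prop
        simpa [hξ] using this.tendsto ξ
      filter_upwards [hn] with η hη
      exact c.eq_one _ ⟨by positivity, hη.le⟩
    exact contDiffAt_const.congr_of_eventuallyEq this
  · exact c.smooth.contDiffAt.comp ξ (contDiffAt_const.mul (contDiffAt_norm ℝ hξ))

lemma contDiff_coord (i : Fin d) :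
    ContDiff ℝ (⊤ : ℕ∞) fun ξ : EuclideanSpace ℝ (Fin d) => ξ i := by
  fun_prop

lemma contDiff_annSymb (c : Cutoff) (i : Fin d) : ContDiff ℝ (⊤ : ℕ∞) (annSymb c i) := by
  refine Complex.ofRealCLM.contDiff.comp
    (g := fun x : ℝ => (x : ℂ)) ?_
  rw [contDiff_iff_contDiffAt]
  intro ξ
  by_cases hξ : ξ = 0
  · have hn : ∀ᶠ η : EuclideanSpace ℝ (Fin d) in nhds ξ, ‖η‖ < 1 / 4 := by
      refine Filter.Tendsto.eventually_lt_const (v := 0) (by norm_num) ?_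
      simpa [hξ] using (continuous_norm (E := EuclideanSpace ℝ (Fin d))).tendsto ξ
    refine (contDiffAt_const (c := (0 : ℝ))).congr_of_eventuallyEq ?_
    filter_upwards [hn] with η hη
    have h0 := norm_nonneg η
    rw [c.eq_one _ ⟨h0, by linarith⟩, c.eq_one _ ⟨by linarith, by linarith⟩, sub_self, zero_mul]
  · have h1 := (contDiff_cutoff_norm (d := d) c 1 one_pos).contDiffAt (x := ξ)
    simp only [one_mul] at h1
    refine (h1.sub (contDiff_cutoff_norm c 2 two_pos).contDiffAt).mul
      ((contDiff_coord i).contDiffAt.div ((contDiffAt_norm ℝ hξ).pow 2) ?_)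
    exact pow_ne_zero _ (norm_ne_zero_iff.mpr hξ)

lemma contDiff_ballSymb (c : Cutoff) (i : Fin d) : ContDiff ℝ (⊤ : ℕ∞) (ballSymb c i) := by
  refine Complex.ofRealCLM.contDiff.comp
    (g := fun x : ℝ => (x : ℂ)) ?_
  have h1 := contDiff_cutoff_norm (d := d) c (1 / 2) (by norm_num)
  simp only [one_div_mul_eq_div] at h1
  exact h1.mul (contDiff_coord i)

lemma hasCompactSupport_annSymb (c : Cutoff) (i : Fin d) : HasCompactSupport (annSymb c i) := by
  refine HasCompactSupport.intro (isCompact_closedBall 0 1) fun ξ hξ => ?_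
  have h1 : 1 < ‖ξ‖ := by simpa using hξ
  rw [annSymb, c.eq_zero _ h1.le, c.eq_zero _ (by linarith), sub_self, zero_mul, ofReal_zero]

lemma hasCompactSupport_ballSymb (c : Cutoff) (i : Fin d) : HasCompactSupport (ballSymb c i) := by
  refine HasCompactSupport.intro (isCompact_closedBall 0 2) fun ξ hξ => ?_
  have h1 : 2 < ‖ξ‖ := by simpa using hξ
  rw [ballSymb, c.eq_zero _ (by linarith), zero_mul, ofReal_zero]

/-! ### Littlewood–Paley symbols -/

lemma sum_lpSymb (c : Cutoff) (J : ℕ) (t : ℝ) :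
    ∑ l ∈ Finset.range (J + 1), lpSymb c l t = c.χ (t / 2 ^ J) := by
  induction J with
  | zero => simp [lpSymb]
  | succ J ih => rw [Finset.sum_range_succ, ih, lpSymb]; ring

lemma lt_of_lpSymb_ne_zero {c : Cutoff} {p : ℕ} {t : ℝ} (h : lpSymb c p t ≠ 0) :
    t < 2 ^ p := by
  contrapose! h
  cases p with
  | zero => exact c.eq_zero _ (by simpa using h)
  | succ p =>
    have h2 : (2 : ℝ) ^ p ≤ t := (pow_le_pow_right₀ one_le_two p.le_succ).trans h
    rw [lpSymb, c.eq_zero _ ((one_le_div (by positivity)).mpr h),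
      c.eq_zero _ ((one_le_div (by positivity)).mpr h2), sub_zero]

lemma two_pow_lt_of_lpSymb_ne_zero {c : Cutoff} {p : ℕ} {t : ℝ} (ht : 0 ≤ t) (hp : p ≠ 0)
    (h : lpSymb c p t ≠ 0) : 2 ^ p < 4 * t := by
  contrapose! h
  obtain ⟨p, rfl⟩ := Nat.exists_eq_succ_of_ne_zero hp
  have h1 : t / 2 ^ p ≤ 1 / 2 := by
    rw [div_le_iff₀ (by positivity)]
    rw [Nat.succ_eq_add_one, pow_succ] at h
    linarith
  have h2 : t / 2 ^ (p + 1) ≤ 1 / 2 :=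
    (div_le_div_of_nonneg_left ht (by positivity)
      (pow_le_pow_right₀ one_le_two p.le_succ)).trans h1
  rw [lpSymb, c.eq_one _ ⟨by positivity, h1⟩, c.eq_one _ ⟨by positivity, h2⟩, sub_self]

lemma hasSum_lpSymb (c : Cutoff) {t : ℝ} (ht : 0 ≤ t) : HasSum (fun p => lpSymb c p t) 1 := by
  obtain ⟨J, hJ⟩ := pow_unbounded_of_one_lt (4 * t) one_lt_two
  have h1 : t / 2 ^ J ≤ 1 / 2 := by
    rw [div_le_iff₀ (by positivity)]
    linarith
  rw [← c.eq_one _ ⟨by positivity, h1⟩, ← sum_lpSymb]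
  refine hasSum_sum_of_ne_finset_zero fun p hp => ?_
  by_contra hne
  have hJp : J + 1 ≤ p := by simpa using hp
  have h2 := two_pow_lt_of_lpSymb_ne_zero ht (by omega) hne
  have h3 : (2 : ℝ) ^ J ≤ 2 ^ p := pow_le_pow_right₀ one_le_two (by omega)
  linarith

lemma annSymb_dilate (c : Cutoff) (i : Fin d) {j : ℕ} (hj : j ≠ 0) (k : Fin d → ℤ) :
    annSymb c i ((2 ^ j : ℝ)⁻¹ • latticePt k) =
      2 ^ j * (lpSymb c j (znorm k) * ((k i : ℂ) / (znorm2 k : ℂ))) := by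
  obtain ⟨j, rfl⟩ := Nat.exists_eq_succ_of_ne_zero hj
  have hn : ‖(2 ^ (j + 1) : ℝ)⁻¹ • latticePt k‖ = znorm k / 2 ^ (j + 1) := by
    rw [norm_smul, norm_inv, norm_pow, Real.norm_ofNat, znorm_eq_norm, inv_mul_eq_div]
  have h2 : 2 * (znorm k / 2 ^ (j + 1)) = znorm k / 2 ^ j := by
    rw [pow_succ]; field_simp
  rw [Nat.succ_eq_add_one, annSymb, hn, h2, lpSymb, PiLp.smul_apply, latticePt_apply, div_pow,
    znorm_sq, smul_eq_mul]
  push_cast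
  field_simp

lemma ballSymb_dilate (c : Cutoff) (i : Fin d) (p : ℕ) {k : Fin d → ℤ} (hk : znorm k < 2 ^ p) :
    ballSymb c i ((2 ^ p : ℝ)⁻¹ • latticePt k) = (2 ^ p)⁻¹ * (k i : ℂ) := by
  have hn : ‖(2 ^ p : ℝ)⁻¹ • latticePt k‖ = znorm k / 2 ^ p := by
    rw [norm_smul, norm_inv, norm_pow, Real.norm_ofNat, znorm_eq_norm, inv_mul_eq_div]
  have h1 : znorm k / 2 ^ p < 1 := (div_lt_one (by positivity)).mpr hk
  have h0 : 0 ≤ znorm k / 2 ^ p := div_nonneg (znorm_nonneg k) (by positivity)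
  rw [ballSymb, hn, c.eq_one _ ⟨by linarith, by linarith⟩, PiLp.smul_apply, latticePt_apply]
  push_cast
  simp

/-! ### Convolutions of trigonometric polynomials -/

section Conv

variable {a b : (Fin d → ℤ) → ℂ}

lemma convC_comm (a b : (Fin d → ℤ) → ℂ) (k : Fin d → ℤ) : convC a b k = convC b a k := by
  rw [convC, convC, ← (Equiv.subLeft k).tsum_eq]
  simp [mul_comm]

lemma convC_eq_sum {s : Finset (Fin d → ℤ)} (hs : ∀ m ∉ s, a m = 0) (k : Fin d → ℤ) :
    convC a b k = ∑ m ∈ s, a m * b (k - m) :=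
  tsum_eq_sum fun m hm => by rw [hs m hm, zero_smul]

lemma exists_ne_zero_of_convC_ne_zero {k : Fin d → ℤ} (h : convC a b k ≠ 0) :
    ∃ m, a m ≠ 0 ∧ b (k - m) ≠ 0 := by
  contrapose! h
  refine (tsum_congr fun m => ?_).trans tsum_zero
  by_cases hm : a m = 0
  · rw [hm, zero_smul]
  · rw [h m hm, smul_zero]

lemma finite_support_convC (ha : (Function.support a).Finite) (hb : (Function.support b).Finite) :
    (Function.support (convC a b)).Finite := by
  refine (Set.Finite.image2 (fun m n => m + n) ha hb).subset fun k hk => ?_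
  obtain ⟨m, hm, hn⟩ := exists_ne_zero_of_convC_ne_zero hk
  exact ⟨m, hm, k - m, hn, add_sub_cancel m k⟩

lemma realize_convC (ha : (Function.support a).Finite) (hb : (Function.support b).Finite)
    (x : Fin d → ℝ) : realize (convC a b) x = realize a x * realize b x := by
  have hab := finite_support_convC ha hb
  have hsb : ∀ m, (Function.support fun k => fChar (k - m) x * b (k - m)).Finite := fun m => by
    refine (hb.image fun n => n + m).subset fun k hk => ⟨k - m, ?_, by simp⟩
    exact fun h => hk (by simp only [h, mul_zero])
  have key : ∀ k, fChar k x • convC a b k =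
      ∑ m ∈ ha.toFinset, fChar m x * a m * (fChar (k - m) x * b (k - m)) := fun k => by
    rw [convC_eq_sum (eq_zero_of_notMem_toFinset ha), smul_eq_mul, Finset.mul_sum]
    refine Finset.sum_congr rfl fun m _ => ?_
    have : fChar k x = fChar m x * fChar (k - m) x := by rw [← fChar_freq_add, add_sub_cancel]
    rw [this]
    ring
  rw [realize, tsum_congr key, Summable.tsum_finsetSum fun m _ =>
      (summable_of_hasFiniteSupport (hsb m)).mul_left _,
    realize_eq_sum (eq_zero_of_notMem_toFinset ha), Finset.sum_mul]
  refine Finset.sum_congr rfl fun m _ => ?_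
  rw [tsum_mul_left, smul_eq_mul]
  congr 1
  exact (Equiv.subRight m).tsum_eq fun n => fChar n x * b n

end Conv

lemma realize_apply {w : VC d} (hw : (Function.support w).Finite) (x : Fin d → ℝ) (i : Fin d) :
    realize w x i = realize (fun k => w k i) x := by
  have hs := eq_zero_of_notMem_toFinset hw
  rw [realize_eq_sum hs, realize_eq_sum (s := hw.toFinset) fun k hk => by rw [hs k hk]; rfl,
    Finset.sum_apply]
  rfl

lemma realize_finset_sum {ι : Type*} (s : Finset ι) {f : ι → (Fin d → ℤ) → ℂ}
    (hf : ∀ i ∈ s, (Function.support (f i)).Finite) (x : Fin d → ℝ) :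
    realize (fun k => ∑ i ∈ s, f i k) x = ∑ i ∈ s, realize (f i) x := by
  simp only [realize, Finset.smul_sum]
  refine Summable.tsum_finsetSum fun i hi => summable_of_hasFiniteSupport ((hf i hi).subset ?_)
  exact fun k hk h => hk (by simp only [h, smul_zero])

lemma realize_const_mul (z : ℂ) (f : (Fin d → ℤ) → ℂ) (x : Fin d → ℝ) :
    realize (fun k => z * f k) x = z * realize f x := by
  simp only [realize, ← tsum_mul_left, smul_eq_mul]
  exact tsum_congr fun k => by ring

/-! ### The pressure as a bilinear operator -/

/-- The bilinear operator `-(2πi) D (D·D)⁻¹ Σ_{a,b} D_a D_b (u_a v_b)`, on Fourier coefficients. -/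
def presForm (u v : VC d) : VC d := fun k i =>
  -(2 * Real.pi * Complex.I) * ((k i : ℂ) / (znorm2 k : ℂ)) *
    ∑ a, ∑ b, (k a : ℂ) * (k b : ℂ) * convC (fun m => u m a) (fun m => v m b) k

lemma presForm_comm (u v : VC d) : presForm u v = presForm v u := by
  funext k i
  rw [presForm, presForm, Finset.sum_comm]
  congr 1
  refine Finset.sum_congr rfl fun a _ => Finset.sum_congr rfl fun b _ => ?_
  rw [convC_comm, mul_comm (k b : ℂ)]

lemma presForm_zero_freq (u v : VC d) : presForm u v 0 = 0 := by
  funext i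
  simp [presForm]

lemma DivFree.sum_mul_sub {u : VC d} (hu : DivFree u) (m k : Fin d → ℤ) :
    ∑ a, u m a * ((k a - m a : ℤ) : ℂ) = ∑ a, (k a : ℂ) * u m a := by
  have h : ∑ a, u m a * ((k a - m a : ℤ) : ℂ) =
      ∑ a, (k a : ℂ) * u m a - ∑ a, (m a : ℂ) * u m a := by
    rw [← Finset.sum_sub_distrib]
    refine Finset.sum_congr rfl fun a _ => ?_
    push_cast
    ring
  rw [h, hu m, sub_zero]

lemma advect_eq {u v : VC d} (hu : DivFree u)
    (hs : ∀ k a b, Summable fun m => u m a * v (k - m) b) (k : Fin d → ℤ) (b : Fin d) :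
    advect u v k b = 2 * Real.pi * Complex.I *
      ∑ a, (k a : ℂ) * convC (fun m => u m a) (fun m => v m b) k := by
  have h : ∀ m, (∑ l, u m l * (((2 * Real.pi : ℝ) : ℂ) * Complex.I * ((k l - m l : ℤ) : ℂ))) *
      v (k - m) b = 2 * Real.pi * Complex.I * ∑ a, (k a : ℂ) * (u m a * v (k - m) b) := fun m => by
    have h1 := hu.sum_mul_sub m k
    have h2 : ∑ l, u m l * (((2 * Real.pi : ℝ) : ℂ) * Complex.I * ((k l - m l : ℤ) : ℂ)) =
        2 * Real.pi * Complex.I * ∑ a, (k a : ℂ) * u m a := by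
      rw [← h1, Finset.mul_sum]
      refine Finset.sum_congr rfl fun l _ => ?_
      push_cast
      ring
    rw [h2, mul_assoc, Finset.sum_mul]
    simp only [mul_assoc]
  rw [advect, tsum_congr h, tsum_mul_left, Summable.tsum_finsetSum fun a _ => (hs k a b).mul_left _]
  simp only [tsum_mul_left, convC, smul_eq_mul]

lemma pressure_eq_presForm {u v : VC d} (hu : DivFree u)
    (hs : ∀ k a b, Summable fun m => u m a * v (k - m) b) :
    gradC (invNegLap (divC (advect u v))) = presForm u v := by
  funext k i
  by_cases hk : k = 0
  · subst hk
    simp [gradC, presForm]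
  · have hπ : (Real.pi : ℂ) ≠ 0 := ofReal_ne_zero.mpr Real.pi_ne_zero
    have hsum : ∑ l, (k l : ℂ) * advect u v k l = 2 * Real.pi * Complex.I *
        ∑ a, ∑ b, (k a : ℂ) * (k b : ℂ) * convC (fun m => u m a) (fun m => v m b) k := by
      rw [Finset.sum_comm, Finset.mul_sum]
      refine Finset.sum_congr rfl fun b _ => ?_
      rw [advect_eq hu hs, Finset.mul_sum, Finset.mul_sum, Finset.mul_sum]
      refine Finset.sum_congr rfl fun a _ => ?_
      ring
    rw [gradC, invNegLap, if_neg hk, divC, hsum, presForm, smul_eq_mul]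
    set S := ∑ a, ∑ b, (k a : ℂ) * (k b : ℂ) * convC (fun m => u m a) (fun m => v m b) k
    by_cases hz : (znorm2 k : ℂ) = 0
    · have hz' : znorm2 k = 0 := by exact_mod_cast hz
      simp [hz']
    push_cast
    field_simp
    ring_nf
    simp only [Complex.I_sq]
    ring

/-- For divergence-free fields both derivatives can be moved onto the factors. -/
lemma presForm_eq_gradients {u v : VC d} (hu : DivFree u) (hv : DivFree v)
    (hfin : (Function.support u).Finite) (k : Fin d → ℤ) (i : Fin d) :
    presForm u v k i = -(2 * Real.pi * Complex.I) * ((k i : ℂ) / (znorm2 k : ℂ)) *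
      ∑ a, ∑ b, convC (fun m => (m b : ℂ) * u m a) (fun m => (m a : ℂ) * v m b) k := by
  have hs := eq_zero_of_notMem_toFinset hfin
  rw [presForm]
  congr 1
  have h1 : ∀ a b, convC (fun m => u m a) (fun m => v m b) k =
      ∑ m ∈ hfin.toFinset, u m a * v (k - m) b := fun a b =>
    convC_eq_sum (fun m hm => by rw [hs m hm]; rfl) k
  have h2 : ∀ a b, convC (fun m => (m b : ℂ) * u m a) (fun m => (m a : ℂ) * v m b) k =
      ∑ m ∈ hfin.toFinset, (m b : ℂ) * u m a * (((k - m) a : ℂ) * v (k - m) b) := fun a b =>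
    convC_eq_sum (fun m hm => by rw [hs m hm]; simp) k
  simp only [h1, h2, Finset.mul_sum]
  have swap : ∀ F : Fin d → Fin d → (Fin d → ℤ) → ℂ,
      ∑ a, ∑ b, ∑ m ∈ hfin.toFinset, F a b m = ∑ m ∈ hfin.toFinset, ∑ a, ∑ b, F a b m :=
    fun F => by
      rw [Finset.sum_comm]
      simp only [Finset.sum_comm (s := Finset.univ) (t := hfin.toFinset)]
      exact Finset.sum_congr rfl fun m _ => Finset.sum_comm
  rw [swap, swap]
  refine Finset.sum_congr rfl fun m _ => ?_
  have hA : ∑ a, ∑ b, (k a : ℂ) * (k b : ℂ) * (u m a * v (k - m) b) =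
      (∑ a, (k a : ℂ) * u m a) * ∑ b, (k b : ℂ) * v (k - m) b := by
    rw [Finset.sum_mul_sum]
    exact Finset.sum_congr rfl fun a _ => Finset.sum_congr rfl fun b _ => by ring
  have hB : ∑ a, ∑ b, (m b : ℂ) * u m a * (((k - m) a : ℂ) * v (k - m) b) =
      (∑ a, u m a * ((k a - m a : ℤ) : ℂ)) * ∑ b, (m b : ℂ) * v (k - m) b := by
    rw [Finset.sum_mul_sum]
    refine Finset.sum_congr rfl fun a _ => Finset.sum_congr rfl fun b _ => ?_
    rw [Pi.sub_apply]
    ring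
  have hC : ∑ b, (m b : ℂ) * v (k - m) b = ∑ b, (k b : ℂ) * v (k - m) b := by
    have h := hv (k - m)
    have h' : ∑ b, (k b : ℂ) * v (k - m) b - ∑ b, (m b : ℂ) * v (k - m) b = 0 := by
      rw [← Finset.sum_sub_distrib, ← h]
      refine Finset.sum_congr rfl fun b _ => ?_
      rw [Pi.sub_apply]
      push_cast
      ring
    exact (sub_eq_zero.mp h').symm
  rw [hA, hB, hu.sum_mul_sub, hC]

/-! ### Estimates for a single dyadic interaction -/

lemma finite_support_of_znorm_lt [Zero E] {a : (Fin d → ℤ) → E} {R : ℝ}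
    (h : ∀ m, a m ≠ 0 → znorm m < R) : (Function.support a).Finite :=
  (finite_znorm_lt R).subset h

lemma finite_support_apply {u : VC d} (hu : (Function.support u).Finite) (i : Fin d) :
    (Function.support fun m => u m i).Finite :=
  hu.subset fun _ hm h => hm (congrFun h i)

lemma norm_realize_apply_le {u : VC d} (hu : (Function.support u).Finite) {X : ℝ}
    (hX : ∀ x, ‖realize u x‖ ≤ X) (i : Fin d) (x : Fin d → ℝ) :
    ‖realize (fun m => u m i) x‖ ≤ X := by
  rw [← realize_apply hu]
  exact (norm_le_pi_norm _ i).trans (hX x)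

lemma finite_support_mul_left {f : (Fin d → ℤ) → ℂ} (hf : (Function.support f).Finite)
    (g : (Fin d → ℤ) → ℂ) : (Function.support fun k => g k * f k).Finite :=
  hf.subset fun k hk h => hk (by simp only [h, mul_zero])

/-- Bernstein's inequality. -/
lemma exists_bernstein_bound (c : Cutoff) (i : Fin d) :
    ∃ C : ℝ, 0 ≤ C ∧ ∀ (p : ℕ) (f : (Fin d → ℤ) → ℂ), (∀ m, f m ≠ 0 → znorm m < 2 ^ p) →
      ∀ A : ℝ, (∀ x, ‖realize f x‖ ≤ A) →
        ∀ x, ‖realize (fun m => (m i : ℂ) * f m) x‖ ≤ C * 2 ^ p * A := by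
  obtain ⟨C, hC, h⟩ :=
    exists_multiplier_bound (contDiff_ballSymb c i) (hasCompactSupport_ballSymb c i)
  refine ⟨C, hC, fun p f hf A hA x => ?_⟩
  have heq : (fun m => (m i : ℂ) * f m) = fun m =>
      (2 ^ p : ℂ) * (ballSymb c i ((2 ^ p : ℝ)⁻¹ • latticePt m) * f m) := by
    funext m
    by_cases hm : f m = 0
    · simp [hm]
    · rw [ballSymb_dilate c i p (hf m hm), ← mul_assoc, mul_inv_cancel_left₀ (by simp)]
  rw [heq, realize_const_mul, norm_mul, norm_pow, Complex.norm_ofNat]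
  have := h (2 ^ p : ℝ)⁻¹ f (finite_support_of_znorm_lt hf) A hA x
  calc _ ≤ 2 ^ p * (C * A) := by gcongr
    _ = C * 2 ^ p * A := by ring

lemma exists_block_presForm_bound_high (c : Cutoff) (i : Fin d) :
    ∃ C : ℝ, 0 ≤ C ∧ ∀ (j : ℕ), j ≠ 0 → ∀ (u v : VC d), (Function.support u).Finite →
      (Function.support v).Finite → ∀ X Y : ℝ, (∀ x, ‖realize u x‖ ≤ X) →
        (∀ x, ‖realize v x‖ ≤ Y) → ∀ x,
          ‖realize (fun k => ((lpSymb c j (znorm k) : ℝ) : ℂ) * presForm u v k i) x‖ ≤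
            C * 2 ^ j * (X * Y) := by
  have hψ : ∀ a b : Fin d, ContDiff ℝ (⊤ : ℕ∞) fun ξ : EuclideanSpace ℝ (Fin d) =>
      annSymb c i ξ * (((ξ a * ξ b : ℝ)) : ℂ) := fun a b =>
    (contDiff_annSymb c i).mul
      (Complex.ofRealCLM.contDiff.comp ((contDiff_coord a).mul (contDiff_coord b)))
  have hc : ∀ a b : Fin d, HasCompactSupport fun ξ : EuclideanSpace ℝ (Fin d) =>
      annSymb c i ξ * (((ξ a * ξ b : ℝ)) : ℂ) := fun a b =>
    (hasCompactSupport_annSymb c i).mul_right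
  choose C hC h using fun a b => exists_multiplier_bound (hψ a b) (hc a b)
  refine ⟨2 * Real.pi * ∑ a, ∑ b, C a b, mul_nonneg (by positivity)
    (Finset.sum_nonneg fun a _ => Finset.sum_nonneg fun b _ => hC a b),
    fun j hj u v hu hv X Y hX hY x => ?_⟩
  have hX0 : 0 ≤ X := (norm_nonneg _).trans (hX 0)
  have heq : (fun k => ((lpSymb c j (znorm k) : ℝ) : ℂ) * presForm u v k i) = fun k =>
      (-(2 * Real.pi * Complex.I) * 2 ^ j) * ∑ a, ∑ b,
        annSymb c i ((2 ^ j : ℝ)⁻¹ • latticePt k) *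
          (((((2 ^ j : ℝ)⁻¹ • latticePt k) a * ((2 ^ j : ℝ)⁻¹ • latticePt k) b : ℝ)) : ℂ) *
          convC (fun m => u m a) (fun m => v m b) k := by
    funext k
    rw [presForm, Finset.mul_sum, Finset.mul_sum, Finset.mul_sum]
    refine Finset.sum_congr rfl fun a _ => ?_
    rw [Finset.mul_sum, Finset.mul_sum, Finset.mul_sum]
    refine Finset.sum_congr rfl fun b _ => ?_
    rw [annSymb_dilate c i hj, PiLp.smul_apply, PiLp.smul_apply, latticePt_apply, latticePt_apply]
    push_cast
    simp only [smul_eq_mul]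
    push_cast
    field_simp
  have hfin : ∀ a b, (Function.support (convC (fun m => u m a) (fun m => v m b))).Finite :=
    fun a b => finite_support_convC (finite_support_apply hu a) (finite_support_apply hv b)
  have hconv : ∀ a b x, ‖realize (convC (fun m => u m a) (fun m => v m b)) x‖ ≤ X * Y :=
    fun a b x => by
      rw [realize_convC (finite_support_apply hu a) (finite_support_apply hv b), norm_mul]
      exact mul_le_mul (norm_realize_apply_le hu hX a x) (norm_realize_apply_le hv hY b x)
        (norm_nonneg _) hX0
  rw [heq, realize_const_mul, realize_finset_sum _ fun a _ => ?_]
  · rw [Finset.sum_congr rfl fun a _ => realize_finset_sum _ (fun b _ =>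
      finite_support_mul_left (hfin a b) _) x, norm_mul]
    have h1 : ‖-(2 * Real.pi * Complex.I) * 2 ^ j‖ = 2 * Real.pi * 2 ^ j := by
      simp [abs_of_pos Real.pi_pos]
    have h2 : ‖∑ a, ∑ b, realize (fun k => annSymb c i ((2 ^ j : ℝ)⁻¹ • latticePt k) *
          (((((2 ^ j : ℝ)⁻¹ • latticePt k) a * ((2 ^ j : ℝ)⁻¹ • latticePt k) b : ℝ)) : ℂ) *
          convC (fun m => u m a) (fun m => v m b) k) x‖ ≤ ∑ a, ∑ b, C a b * (X * Y) := by
      refine norm_sum_le_of_le _ fun a _ => norm_sum_le_of_le _ fun b _ => ?_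
      exact h a b _ _ (hfin a b) _ (hconv a b) x
    rw [h1]
    refine (mul_le_mul_of_nonneg_left h2 (by positivity)).trans_eq ?_
    simp only [← Finset.sum_mul]
    ring
  · refine (hu.add hv).subset fun k hk => ?_
    obtain ⟨b, _, hb⟩ := Finset.exists_ne_zero_of_sum_ne_zero hk
    obtain ⟨m, hm, hn⟩ := exists_ne_zero_of_convC_ne_zero (right_ne_zero_of_mul hb)
    refine ⟨m, fun h0 => hm ?_, k - m, fun h0 => hn ?_, add_sub_cancel m k⟩
    · simp [h0]
    · simp [h0]

lemma exists_block_presForm_bound_low (c : Cutoff) (i : Fin d) :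
    ∃ C : ℝ, 0 ≤ C ∧ ∀ (j p q : ℕ), j ≠ 0 → ∀ (u v : VC d), DivFree u → DivFree v →
      (∀ m, u m ≠ 0 → znorm m < 2 ^ p) → (∀ m, v m ≠ 0 → znorm m < 2 ^ q) →
      ∀ X Y : ℝ, (∀ x, ‖realize u x‖ ≤ X) → (∀ x, ‖realize v x‖ ≤ Y) → ∀ x,
          ‖realize (fun k => ((lpSymb c j (znorm k) : ℝ) : ℂ) * presForm u v k i) x‖ ≤
            C * (2 ^ p * 2 ^ q / 2 ^ j) * (X * Y) := by
  obtain ⟨C, hC, h⟩ :=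
    exists_multiplier_bound (contDiff_annSymb c i) (hasCompactSupport_annSymb c i)
  choose B hB hb using fun a => exists_bernstein_bound (d := d) c a
  refine ⟨2 * Real.pi * (C * ∑ a, ∑ b, B b * B a), mul_nonneg (by positivity) (mul_nonneg hC
    (Finset.sum_nonneg fun a _ => Finset.sum_nonneg fun b _ => mul_nonneg (hB b) (hB a))),
    fun j p q hj u v hdu hdv hu' hv' X Y hX hY x => ?_⟩
  have hu := finite_support_of_znorm_lt hu'
  have hv := finite_support_of_znorm_lt hv'
  have hX0 : 0 ≤ X := (norm_nonneg _).trans (hX 0)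
  set S : (Fin d → ℤ) → ℂ := fun k =>
    ∑ a, ∑ b, convC (fun m => (m b : ℂ) * u m a) (fun m => (m a : ℂ) * v m b) k with hS
  have heq : (fun k => ((lpSymb c j (znorm k) : ℝ) : ℂ) * presForm u v k i) = fun k =>
      (-(2 * Real.pi * Complex.I) * (2 ^ j)⁻¹) *
        (annSymb c i ((2 ^ j : ℝ)⁻¹ • latticePt k) * S k) := by
    funext k
    rw [presForm_eq_gradients hdu hdv hu, annSymb_dilate c i hj, hS]
    field_simp
  have hfin : ∀ a b, (Function.support
      (convC (fun m => (m b : ℂ) * u m a) (fun m => (m a : ℂ) * v m b))).Finite :=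
    fun a b => finite_support_convC (finite_support_mul_left (finite_support_apply hu a) _)
      (finite_support_mul_left (finite_support_apply hv b) _)
  have hfinS' : ∀ a, (Function.support fun k => ∑ b,
      convC (fun m => (m b : ℂ) * u m a) (fun m => (m a : ℂ) * v m b) k).Finite := fun a => by
    refine (Set.finite_iUnion fun b => hfin a b).subset fun k hk => ?_
    obtain ⟨b, _, hb⟩ := Finset.exists_ne_zero_of_sum_ne_zero hk
    exact Set.mem_iUnion.mpr ⟨b, hb⟩
  have hfinS : (Function.support S).Finite := by
    refine (Set.finite_iUnion hfinS').subset fun k hk => ?_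
    obtain ⟨a, _, ha⟩ := Finset.exists_ne_zero_of_sum_ne_zero hk
    exact Set.mem_iUnion.mpr ⟨a, ha⟩
  have hSb : ∀ x, ‖realize S x‖ ≤ ∑ a, ∑ b, (B b * 2 ^ p * X) * (B a * 2 ^ q * Y) := fun x => by
    rw [hS, realize_finset_sum _ fun a _ => hfinS' a]
    refine norm_sum_le_of_le _ fun a _ => ?_
    rw [realize_finset_sum _ fun b _ => hfin a b]
    refine norm_sum_le_of_le _ fun b _ => ?_
    rw [realize_convC (finite_support_mul_left (finite_support_apply hu a) _)
      (finite_support_mul_left (finite_support_apply hv b) _), norm_mul]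
    have h1 := hb b p (fun m => u m a) (fun m hm => hu' m fun h0 => hm (by simp [h0])) X
      (norm_realize_apply_le hu hX a) x
    have h2 := hb a q (fun m => v m b) (fun m hm => hv' m fun h0 => hm (by simp [h0])) Y
      (norm_realize_apply_le hv hY b) x
    exact mul_le_mul h1 h2 (norm_nonneg _)
      (mul_nonneg (mul_nonneg (hB b) (by positivity)) hX0)
  rw [heq, realize_const_mul, norm_mul]
  have h1 : ‖-(2 * Real.pi * Complex.I) * (2 ^ j)⁻¹‖ = 2 * Real.pi * (2 ^ j)⁻¹ := by
    simp [abs_of_pos Real.pi_pos]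
  rw [h1]
  refine (mul_le_mul_of_nonneg_left (h _ _ hfinS _ hSb x) (by positivity)).trans_eq ?_
  have h2 : ∑ a, ∑ b, (B b * 2 ^ p * X) * (B a * 2 ^ q * Y) =
      (∑ a, ∑ b, B b * B a) * (2 ^ p * 2 ^ q * (X * Y)) := by
    simp only [Finset.sum_mul]
    exact Finset.sum_congr rfl fun a _ => Finset.sum_congr rfl fun b _ => by ring
  rw [h2]
  field_simp

lemma finite_support_blockC [NormedAddCommGroup E] [NormedSpace ℂ E] (c : Cutoff) (j : ℕ)
    (a : (Fin d → ℤ) → E) : (Function.support (blockC c j a)).Finite := by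
  refine finite_support_of_znorm_lt (R := 2 ^ j) fun m hm => lt_of_lpSymb_ne_zero (c := c) ?_
  exact fun h => hm (by rw [blockC, h, ofReal_zero, zero_smul])

/-- The dyadic block of the pressure of a pair of localized divergence-free fields. -/
lemma exists_block_presForm_bound (d : ℕ) (c : Cutoff) :
    ∃ C : ℝ, 0 ≤ C ∧ ∀ (j p q : ℕ) (u v : VC d), DivFree u → DivFree v →
      (∀ m, u m ≠ 0 → znorm m < 2 ^ p) → (∀ m, v m ≠ 0 → znorm m < 2 ^ q) →
      ∀ X Y : ℝ, (∀ x, ‖realize u x‖ ≤ X) → (∀ x, ‖realize v x‖ ≤ Y) → ∀ x,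
          ‖realize (blockC c j (presForm u v)) x‖ ≤
            C * min (2 ^ j) (2 ^ p * 2 ^ q / 2 ^ j) * (X * Y) := by
  choose C hC h using fun i => exists_block_presForm_bound_high (d := d) c i
  choose D hD h' using fun i => exists_block_presForm_bound_low (d := d) c i
  have hS : ∀ i, C i + D i ≤ ∑ i, (C i + D i) := fun i =>
    Finset.single_le_sum (f := fun i => C i + D i) (fun i _ => add_nonneg (hC i) (hD i))
      (Finset.mem_univ i)
  have hS0 : 0 ≤ ∑ i, (C i + D i) := Finset.sum_nonneg fun i _ => add_nonneg (hC i) (hD i)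
  refine ⟨∑ i, (C i + D i), hS0, fun j p q u v hdu hdv hu hv X Y hX hY x => ?_⟩
  have hXY : 0 ≤ X * Y :=
    mul_nonneg ((norm_nonneg _).trans (hX 0)) ((norm_nonneg _).trans (hY 0))
  have hnn : 0 ≤ (∑ i, (C i + D i)) * min (2 ^ j) (2 ^ p * 2 ^ q / 2 ^ j) * (X * Y) := by
    positivity
  rw [pi_norm_le_iff_of_nonneg hnn]
  intro i
  rw [realize_apply (finite_support_blockC c j _)]
  by_cases hj : j = 0
  · have h0 : (fun k => blockC c j (presForm u v) k i) = fun _ => 0 := by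
      funext k
      by_cases hk : lpSymb c j (znorm k) = 0
      · simp [blockC, hk]
      · have hk1 := lt_of_lpSymb_ne_zero hk
        rw [hj, pow_zero] at hk1
        have hk0 : k = 0 := by
          funext a
          have := (abs_apply_le_znorm k a).trans_lt hk1
          have h3 : |k a| < 1 := by exact_mod_cast this
          exact Int.abs_lt_one_iff.mp h3
        rw [blockC, hk0, presForm_zero_freq, smul_zero]
        rfl
    rw [h0]
    simpa [realize] using hnn
  · have h1 := h i j hj u v (finite_support_of_znorm_lt hu) (finite_support_of_znorm_lt hv)
      X Y hX hY x
    have h2 := h' i j p q hj u v hdu hdv hu hv X Y hX hY x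
    refine le_trans ?_ (mul_le_mul_of_nonneg_right (mul_le_mul_of_nonneg_right (hS i)
      (by positivity)) hXY)
    rcases min_cases (2 ^ j : ℝ) (2 ^ p * 2 ^ q / 2 ^ j) with ⟨hm, _⟩ | ⟨hm, _⟩
    · rw [hm]
      refine h1.trans ?_
      gcongr
      exact le_add_of_nonneg_right (hD i)
    · rw [hm]
      refine h2.trans ?_
      gcongr
      exact le_add_of_nonneg_left (hC i)

/-! ### Convergence of the dyadic decomposition of the pressure -/

section Blocks

variable [NormedAddCommGroup E] [NormedSpace ℂ E]

lemma lpSymb_ne_zero_of_blockC_ne_zero {c : Cutoff} {p : ℕ} {a : (Fin d → ℤ) → E}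
    {m : Fin d → ℤ} (h : blockC c p a m ≠ 0) : lpSymb c p (znorm m) ≠ 0 := fun h0 =>
  h (by rw [blockC, h0, ofReal_zero, zero_smul])

lemma hasSum_blockC (c : Cutoff) (a : (Fin d → ℤ) → E) (m : Fin d → ℤ) :
    HasSum (fun p => blockC c p a m) (a m) := by
  have h := (Complex.hasSum_ofReal.mpr (hasSum_lpSymb c (znorm_nonneg m))).smul_const (a m)
  rwa [ofReal_one, one_smul] at h

end Blocks

lemma blockC_apply (c : Cutoff) (p : ℕ) (u : VC d) (m : Fin d → ℤ) (i : Fin d) :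
    blockC c p u m i = blockC c p (fun k => u k i) m := rfl

lemma DivFree.blockC {u : VC d} (hu : DivFree u) (c : Cutoff) (p : ℕ) :
    DivFree (blockC c p u) := fun k => by
  have h : ∀ i, (k i : ℂ) * _root_.blockC c p u k i =
      ((lpSymb c p (znorm k) : ℝ) : ℂ) * ((k i : ℂ) * u k i) := fun i => by
    rw [blockC_apply, _root_.blockC, smul_eq_mul]
    ring
  rw [Finset.sum_congr rfl fun i _ => h i, ← Finset.mul_sum, hu k, mul_zero]

/-- Two frequencies in dyadic shells adding up to a given one have comparable sizes. -/
lemma one_le_weight {c : Cutoff} {σ : ℝ} (hσ : -1 ≤ σ) {p q : ℕ} {m k : Fin d → ℤ}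
    (hp : lpSymb c p (znorm m) ≠ 0) (hq : lpSymb c q (znorm (k - m)) ≠ 0) :
    1 ≤ 4 * (znorm k + 1) * ((2 : ℝ) ^ ((p : ℝ) * σ) * (2 : ℝ) ^ ((q : ℝ) * 1)) := by
  have hk := znorm_nonneg k
  have hm0 := znorm_nonneg m
  rw [mul_one, Real.rpow_natCast]
  have hq1 : (1 : ℝ) ≤ 2 ^ q := one_le_pow₀ one_le_two
  rcases eq_or_ne p 0 with rfl | hp0
  · rw [Nat.cast_zero, zero_mul, Real.rpow_zero, one_mul]
    nlinarith
  · have h1 := two_pow_lt_of_lpSymb_ne_zero hm0 hp0 hp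
    have h2 := lt_of_lpSymb_ne_zero hq
    have h3 : znorm m ≤ znorm k + znorm (k - m) := by
      have := znorm_add_le k (-(k - m))
      rwa [znorm_neg, ← sub_eq_add_neg, sub_sub_cancel] at this
    have h4 : (2 : ℝ) ^ p ≤ 4 * (znorm k + 1) * 2 ^ q := by nlinarith
    have h5 : (1 : ℝ) ≤ 2 ^ ((p : ℝ) * σ) * 2 ^ p := by
      rw [← Real.rpow_natCast 2 p, ← Real.rpow_add two_pos]
      refine Real.one_le_rpow one_le_two ?_
      have : (0 : ℝ) ≤ p := Nat.cast_nonneg p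
      nlinarith
    calc (1 : ℝ) ≤ 2 ^ ((p : ℝ) * σ) * 2 ^ p := h5
      _ ≤ 2 ^ ((p : ℝ) * σ) * (4 * (znorm k + 1) * 2 ^ q) := by gcongr
      _ = _ := by ring

lemma sum_norm_mul_norm_le {a b : (Fin d → ℤ) → ℂ} (ha : (Function.support a).Finite)
    (hb : (Function.support b).Finite) {A B : ℝ} (hA : ∀ x, ‖realize a x‖ ≤ A)
    (hB : ∀ x, ‖realize b x‖ ≤ B) (k : Fin d → ℤ) (s : Finset (Fin d → ℤ)) :
    ∑ m ∈ s, ‖a m * b (k - m)‖ ≤ A * B := by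
  classical
  have hA0 : 0 ≤ A := (norm_nonneg _).trans (hA 0)
  have hB0 : 0 ≤ B := (norm_nonneg _).trans (hB 0)
  have h1 := sum_sq_norm_coeff_le ha hA0 hA s
  have h2 := sum_sq_norm_coeff_le hb hB0 hB (s.map (Equiv.subLeft k).toEmbedding)
  rw [Finset.sum_map] at h2
  simp only [norm_mul]
  refine (Real.sum_mul_le_sqrt_mul_sqrt s _ _).trans ?_
  exact mul_le_mul (Real.sqrt_le_iff.mpr ⟨hA0, h1⟩) (Real.sqrt_le_iff.mpr ⟨hB0, h2⟩)
    (Real.sqrt_nonneg _) hA0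

lemma tsum_norm_mul_norm_blockC_le {c : Cutoff} {σ : ℝ} (hσ : -1 ≤ σ) {p q : ℕ}
    {a b : (Fin d → ℤ) → ℂ} {A B : ℝ} (hA : ∀ x, ‖realize (blockC c p a) x‖ ≤ A)
    (hB : ∀ x, ‖realize (blockC c q b) x‖ ≤ B) (k : Fin d → ℤ) :
    ∑' m, ‖blockC c p a m * blockC c q b (k - m)‖ ≤ 4 * (znorm k + 1) *
      (((2 : ℝ) ^ ((p : ℝ) * σ) * A) * ((2 : ℝ) ^ ((q : ℝ) * 1) * B)) := by
  have hA0 : 0 ≤ A := (norm_nonneg _).trans (hA 0)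
  have hB0 : 0 ≤ B := (norm_nonneg _).trans (hB 0)
  have hk := znorm_nonneg k
  by_cases h : ∃ m, blockC c p a m ≠ 0 ∧ blockC c q b (k - m) ≠ 0
  · obtain ⟨m, hm, hm'⟩ := h
    have hw := one_le_weight hσ (lpSymb_ne_zero_of_blockC_ne_zero hm)
      (lpSymb_ne_zero_of_blockC_ne_zero hm')
    have hsum : ∑' m, ‖blockC c p a m * blockC c q b (k - m)‖ ≤ A * B :=
      Real.tsum_le_of_sum_le (fun _ => norm_nonneg _) fun s =>
        sum_norm_mul_norm_le (finite_support_blockC c p a) (finite_support_blockC c q b)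
          hA hB k s
    refine hsum.trans ((le_mul_of_one_le_left (mul_nonneg hA0 hB0) hw).trans_eq ?_)
    ring
  · push Not at h
    have h0 : ∀ m, ‖blockC c p a m * blockC c q b (k - m)‖ = 0 := fun m => by
      by_cases hm : blockC c p a m = 0
      · rw [hm, zero_mul, norm_zero]
      · rw [h m hm, mul_zero, norm_zero]
    rw [tsum_congr h0, tsum_zero]
    positivity

lemma summable_and_hasSum_convC_blockC {c : Cutoff} {σ : ℝ} (hσ : -1 ≤ σ)
    {a b : (Fin d → ℤ) → ℂ} {X Y : ℕ → ℝ}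
    (hX : ∀ p x, ‖realize (blockC c p a) x‖ ≤ X p) (hY : ∀ q x, ‖realize (blockC c q b) x‖ ≤ Y q)
    (hXs : Summable fun p : ℕ => (2 : ℝ) ^ ((p : ℝ) * σ) * X p)
    (hYs : Summable fun q : ℕ => (2 : ℝ) ^ ((q : ℝ) * 1) * Y q) (k : Fin d → ℤ) :
    (Summable fun m => a m * b (k - m)) ∧
      HasSum (fun pq : ℕ × ℕ => convC (blockC c pq.1 a) (blockC c pq.2 b) k) (convC a b k) := by
  have hX0 : ∀ p, 0 ≤ X p := fun p => (norm_nonneg _).trans (hX p 0)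
  have hY0 : ∀ q, 0 ≤ Y q := fun q => (norm_nonneg _).trans (hY q 0)
  obtain ⟨F, hF⟩ : ∃ F : (ℕ × ℕ) × (Fin d → ℤ) → ℂ, ∀ p q m,
      F ((p, q), m) = blockC c p a m * blockC c q b (k - m) := ⟨fun z =>
    blockC c z.1.1 a z.2 * blockC c z.1.2 b (k - z.2), fun _ _ _ => rfl⟩
  have hfibs : ∀ pq, Summable fun m => F (pq, m) := fun ⟨p, q⟩ => by
    simp only [hF]
    exact summable_of_hasFiniteSupport ((finite_support_blockC c p a).subset
      fun m hm => left_ne_zero_of_mul hm)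
  have hbound : ∀ pq : ℕ × ℕ, ∑' m, ‖F (pq, m)‖ ≤ 4 * (znorm k + 1) *
      (((2 : ℝ) ^ ((pq.1 : ℝ) * σ) * X pq.1) * ((2 : ℝ) ^ ((pq.2 : ℝ) * 1) * Y pq.2)) :=
    fun ⟨p, q⟩ => by
      simp only [hF]
      exact tsum_norm_mul_norm_blockC_le hσ (hX p) (hY q) k
  have hFs : Summable F := by
    refine Summable.of_norm ((summable_prod_of_nonneg fun _ => norm_nonneg _).mpr
      ⟨fun pq => (hfibs pq).norm, ?_⟩)
    refine Summable.of_nonneg_of_le (fun pq => tsum_nonneg fun _ => norm_nonneg _) hbound ?_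
    refine Summable.mul_left _ (hXs.mul_of_nonneg hYs (fun p => ?_) fun q => ?_)
    · exact mul_nonneg (by positivity) (hX0 p)
    · exact mul_nonneg (by positivity) (hY0 q)
  have h1 : HasSum (fun pq : ℕ × ℕ => convC (blockC c pq.1 a) (blockC c pq.2 b) k)
      (∑' z, F z) := by
    refine hFs.hasSum.prod_fiberwise fun ⟨p, q⟩ => ?_
    have h := (hfibs (p, q)).hasSum
    simp only [hF] at h ⊢
    exact h
  have hsw : HasSum (fun z : (Fin d → ℤ) × (ℕ × ℕ) => F (z.2, z.1)) (∑' z, F z) :=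
    (Equiv.prodComm _ _).hasSum_iff.mpr hFs.hasSum
  have h2 : HasSum (fun m => a m * b (k - m)) (∑' z, F z) := by
    refine hsw.prod_fiberwise fun m => ?_
    have hs := hsw.summable.prod_factor m
    have heq : ∀ pq : ℕ × ℕ, F (pq, m) = blockC c pq.1 a m * blockC c pq.2 b (k - m) :=
      fun ⟨p, q⟩ => hF p q m
    simp only [heq] at hs ⊢
    have ha : HasSum (fun p => blockC c p a m) (a m) := hasSum_blockC c a m
    have hb : HasSum (fun q => blockC c q b (k - m)) (b (k - m)) := hasSum_blockC c b (k - m)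
    generalize a m = α at ha ⊢
    generalize b (k - m) = β at hb ⊢
    exact HasSum.mul (f := fun p => blockC c p a m) (g := fun q => blockC c q b (k - m)) ha hb hs
  refine ⟨h2.summable, ?_⟩
  have h3 : convC a b k = ∑' z, F z := h2.tsum_eq
  rwa [h3]

/-! ### Summation over the dyadic interactions -/

lemma dyadic_separation {p q j : ℕ} {x y z : ℝ} (hpq : p + 4 ≤ q) (hx : x < 2 ^ p)
    (hy : y < 2 ^ q) (hy' : q ≠ 0 → 2 ^ q < 4 * y) (hz : z < 2 ^ j) (hz' : j ≠ 0 → 2 ^ j < 4 * z)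
    (hzxy : z ≤ x + y) (hyzx : y ≤ z + x) : j ≤ q + 2 ∧ q ≤ j + 2 := by
  have hpq' : (2 : ℝ) ^ p * 2 ^ 4 ≤ 2 ^ q := by
    rw [← pow_add]
    exact pow_le_pow_right₀ one_le_two hpq
  have hq0 : (0 : ℝ) < 2 ^ q := by positivity
  constructor
  · by_contra! h
    have h1 : (2 : ℝ) ^ q * 2 ^ 3 ≤ 2 ^ j := by
      rw [← pow_add]
      exact pow_le_pow_right₀ one_le_two h
    have := hz' (by omega)
    linarith
  · by_contra! h
    have h1 : (2 : ℝ) ^ j * 2 ^ 3 ≤ 2 ^ q := by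
      rw [← pow_add]
      exact pow_le_pow_right₀ one_le_two h
    have := hy' (by omega)
    linarith

/-- The exponential weight, decaying away from the diagonal, that controls the frequency
interactions. -/
def diagWeight (σ : ℝ) (z : ℤ) : ℝ := (2 : ℝ) ^ (-(1 + σ) * |(z : ℝ)|)

lemma diagWeight_nonneg (σ : ℝ) (z : ℤ) : 0 ≤ diagWeight σ z := by
  unfold diagWeight
  positivity

lemma summable_diagWeight {σ : ℝ} (hσ : -1 < σ) : Summable (diagWeight σ) := by
  have h : Summable fun n : ℕ => ((2 : ℝ) ^ (-(1 + σ))) ^ n :=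
    summable_geometric_of_lt_one (by positivity)
      (Real.rpow_lt_one_of_one_lt_of_neg one_lt_two (by linarith))
  have heq : ∀ n : ℕ, ((2 : ℝ) ^ (-(1 + σ))) ^ n = (2 : ℝ) ^ (-(1 + σ) * (n : ℝ)) := fun n => by
    rw [Real.rpow_mul two_pos.le, Real.rpow_natCast]
  simp only [heq] at h
  refine Summable.of_nat_of_neg ?_ ?_ <;> simpa [diagWeight] using h

lemma interaction_bound {c : Cutoff} {σ : ℝ} (hσ₁ : -1 < σ) (hσ₂ : σ ≤ 1) {j p q : ℕ}
    {m n : Fin d → ℤ} (hp : lpSymb c p (znorm m) ≠ 0) (hq : lpSymb c q (znorm n) ≠ 0)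
    (hj : lpSymb c j (znorm (m + n)) ≠ 0) :
    (2 : ℝ) ^ ((j : ℝ) * σ) * min (2 ^ j) (2 ^ p * 2 ^ q / 2 ^ j) ≤
      2 ^ (27 : ℝ) * (diagWeight σ (j - p) + diagWeight σ (j - q)) *
        ((2 : ℝ) ^ ((p : ℝ) * σ) * (2 : ℝ) ^ ((q : ℝ) * 1)) := by
  have hp1 := lt_of_lpSymb_ne_zero hp
  have hq1 := lt_of_lpSymb_ne_zero hq
  have hj1 := lt_of_lpSymb_ne_zero hj
  have hp2 := fun h => two_pow_lt_of_lpSymb_ne_zero (znorm_nonneg m) h hp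
  have hq2 := fun h => two_pow_lt_of_lpSymb_ne_zero (znorm_nonneg n) h hq
  have hj2 := fun h => two_pow_lt_of_lpSymb_ne_zero (znorm_nonneg (m + n)) h hj
  have t1 := znorm_add_le m n
  have t2 : znorm n ≤ znorm (m + n) + znorm m := by
    simpa [znorm_neg] using znorm_add_le (m + n) (-m)
  have t3 : znorm m ≤ znorm (m + n) + znorm n := by
    simpa [znorm_neg] using znorm_add_le (m + n) (-n)
  have hDp := diagWeight_nonneg σ (j - p)
  have hDq := diagWeight_nonneg σ (j - q)
  have hlow : (2 : ℝ) ^ ((j : ℝ) * σ) * (2 ^ p * 2 ^ q / 2 ^ j) =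
      (2 : ℝ) ^ ((j : ℝ) * σ + (p + q - j)) := by
    rw [Real.rpow_add two_pos, Real.rpow_sub two_pos, Real.rpow_add two_pos]
    simp only [Real.rpow_natCast]
  have hhigh : (2 : ℝ) ^ ((j : ℝ) * σ) * 2 ^ j = (2 : ℝ) ^ ((j : ℝ) * σ + j) := by
    rw [Real.rpow_add two_pos, Real.rpow_natCast]
  have hrhs : ∀ l : ℕ, (2 : ℝ) ^ (27 : ℝ) * diagWeight σ (j - l) *
      ((2 : ℝ) ^ ((p : ℝ) * σ) * (2 : ℝ) ^ ((q : ℝ) * 1)) =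
      (2 : ℝ) ^ (27 + -(1 + σ) * |(j : ℝ) - l| + (p * σ + q * 1)) := fun l => by
    rw [Real.rpow_add two_pos, Real.rpow_add two_pos, Real.rpow_add two_pos, diagWeight]
    push_cast
    rfl
  rcases le_or_gt (p + 4) q with hpq | hpq
  · obtain ⟨h1, h2⟩ := dyadic_separation hpq hp1 hq1 hq2 hj1 hj2 t1 t2
    have h1' : (j : ℝ) ≤ q + 2 := by exact_mod_cast h1
    have h2' : (q : ℝ) ≤ j + 2 := by exact_mod_cast h2
    have hpj : (p : ℝ) ≤ j := by exact_mod_cast (by omega : p ≤ j)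
    have habs : |(j : ℝ) - q| ≤ 2 := abs_le.mpr ⟨by linarith, by linarith⟩
    calc _ ≤ (2 : ℝ) ^ ((j : ℝ) * σ) * (2 ^ p * 2 ^ q / 2 ^ j) := by
          gcongr
          exact min_le_right _ _
      _ ≤ 2 ^ (27 : ℝ) * diagWeight σ (j - q) *
          ((2 : ℝ) ^ ((p : ℝ) * σ) * (2 : ℝ) ^ ((q : ℝ) * 1)) := by
          rw [hlow, hrhs]
          refine Real.rpow_le_rpow_of_exponent_le one_le_two ?_
          have e1 := mul_nonneg (sub_nonneg.mpr hσ₂) (sub_nonneg.mpr hpj)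
          have e2 := mul_nonneg (by linarith : 0 ≤ 1 + σ) (sub_nonneg.mpr habs)
          linarith
      _ ≤ _ := by
          gcongr
          exact le_add_of_nonneg_left hDp
  rcases le_or_gt (q + 4) p with hqp | hqp
  · obtain ⟨h1, h2⟩ := dyadic_separation hqp hq1 hp1 hp2 hj1 hj2 (by linarith) t3
    have h1' : (j : ℝ) ≤ p + 2 := by exact_mod_cast h1
    have h2' : (p : ℝ) ≤ j + 2 := by exact_mod_cast h2
    have habs : |(j : ℝ) - p| ≤ 2 := abs_le.mpr ⟨by linarith, by linarith⟩
    calc _ ≤ (2 : ℝ) ^ ((j : ℝ) * σ) * (2 ^ p * 2 ^ q / 2 ^ j) := by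
          gcongr
          exact min_le_right _ _
      _ ≤ 2 ^ (27 : ℝ) * diagWeight σ (j - p) *
          ((2 : ℝ) ^ ((p : ℝ) * σ) * (2 : ℝ) ^ ((q : ℝ) * 1)) := by
          rw [hlow, hrhs]
          refine Real.rpow_le_rpow_of_exponent_le one_le_two ?_
          have e1 := mul_nonneg (sub_nonneg.mpr hσ₂) (sub_nonneg.mpr h2')
          have e2 := mul_nonneg (by linarith : 0 ≤ 1 + σ) (sub_nonneg.mpr habs)
          linarith
      _ ≤ _ := by
          gcongr
          exact le_add_of_nonneg_right hDq
  · have hqp' : (2 : ℝ) ^ q ≤ 2 ^ p * 2 ^ 3 := by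
      rw [← pow_add]
      exact pow_le_pow_right₀ one_le_two (by omega)
    have hjp : j ≤ p + 6 := by
      by_contra! h
      have h1 : (2 : ℝ) ^ p * 2 ^ 7 ≤ 2 ^ j := by
        rw [← pow_add]
        exact pow_le_pow_right₀ one_le_two h
      have := hj2 (by omega)
      have hp0 : (0 : ℝ) < 2 ^ p := by positivity
      linarith
    have hjp' : (j : ℝ) ≤ p + 6 := by exact_mod_cast hjp
    have hpq' : (p : ℝ) ≤ q + 3 := by exact_mod_cast (by omega : p ≤ q + 3)
    have habs : (j : ℝ) - p + |(j : ℝ) - p| ≤ 12 := by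
      rcases abs_cases ((j : ℝ) - p) with ⟨h, _⟩ | ⟨h, _⟩ <;> linarith
    calc _ ≤ (2 : ℝ) ^ ((j : ℝ) * σ) * 2 ^ j := by
          gcongr
          exact min_le_left _ _
      _ ≤ 2 ^ (27 : ℝ) * diagWeight σ (j - p) *
          ((2 : ℝ) ^ ((p : ℝ) * σ) * (2 : ℝ) ^ ((q : ℝ) * 1)) := by
          rw [hhigh, hrhs]
          refine Real.rpow_le_rpow_of_exponent_le one_le_two ?_
          have e2 := mul_nonneg (by linarith : 0 ≤ 1 + σ) (sub_nonneg.mpr habs)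
          linarith
      _ ≤ _ := by
          gcongr
          exact le_add_of_nonneg_right hDq

section Besov

variable [NormedAddCommGroup E] [NormedSpace ℂ E]

lemma besov_one_eq (c : Cutoff) (s : ℝ) (p : ℝ≥0∞) (a : (Fin d → ℤ) → E) :
    besov c s p 1 a = ∑' j : ℕ, (2 : ℝ≥0∞) ^ ((j : ℝ) * s) * tLp p (blockC c j a) := by
  simp [besov, lr]

lemma two_rpow_eq_ofReal (t : ℝ) : (2 : ℝ≥0∞) ^ t = ENNReal.ofReal ((2 : ℝ) ^ t) := by
  rw [← ENNReal.ofReal_rpow_of_pos two_pos, ENNReal.ofReal_ofNat]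

lemma exists_block_bound_of_besov_ne_top {c : Cutoff} {s : ℝ} {a : (Fin d → ℤ) → E}
    (h : besov c s ∞ 1 a ≠ ∞) : ∃ X : ℕ → ℝ, (∀ p x, ‖realize (blockC c p a) x‖ ≤ X p) ∧
      (Summable fun p : ℕ => (2 : ℝ) ^ ((p : ℝ) * s) * X p) ∧
      ∑' p : ℕ, ENNReal.ofReal ((2 : ℝ) ^ ((p : ℝ) * s) * X p) = besov c s ∞ 1 a := by
  rw [besov_one_eq] at h ⊢
  have hfin : ∀ p : ℕ, tLp ∞ (blockC c p a) ≠ ∞ := fun p hp => by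
    refine ENNReal.ne_top_of_tsum_ne_top h p ?_
    rw [hp, two_rpow_eq_ofReal]
    exact ENNReal.mul_top (ENNReal.ofReal_pos.mpr (by positivity)).ne'
  refine ⟨fun p => (tLp ∞ (blockC c p a)).toReal, fun p x => ?_, ?_, ?_⟩
  · rw [← toReal_enorm]
    exact ENNReal.toReal_mono (hfin p) (enorm_realize_le_tLp (finite_support_blockC c p a) x)
  · refine (ENNReal.summable_toReal h).congr fun p => ?_
    rw [ENNReal.toReal_mul, two_rpow_eq_ofReal, ENNReal.toReal_ofReal (by positivity)]
  · refine tsum_congr fun p => ?_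
    rw [ENNReal.ofReal_mul (by positivity), ← two_rpow_eq_ofReal, ENNReal.ofReal_toReal (hfin p)]

lemma besov_zero (c : Cutoff) (s : ℝ) : besov c s ∞ 1 (0 : (Fin d → ℤ) → E) = 0 := by
  rw [besov_one_eq]
  refine ENNReal.tsum_eq_zero.mpr fun j => ?_
  have h : tLp ∞ (blockC c j (0 : (Fin d → ℤ) → E)) ≤ 0 := tLp_top_le fun x => by
    simp [realize, blockC]
  rw [nonpos_iff_eq_zero.mp h, mul_zero]

end Besov

lemma eq_zero_of_besov_eq_zero {c : Cutoff} {s : ℝ} {u : VC d} (h : besov c s ∞ 1 u = 0) :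
    u = 0 := by
  rw [besov_one_eq, ENNReal.tsum_eq_zero] at h
  have hb : ∀ p i m, blockC c p u m i = 0 := fun p i m => by
    have h1 : tLp ∞ (blockC c p u) = 0 := by
      refine (mul_eq_zero.mp (h p)).resolve_left ?_
      rw [two_rpow_eq_ofReal]
      exact (ENNReal.ofReal_pos.mpr (by positivity)).ne'
    have h2 : ∀ x, ‖realize (blockC c p u) x‖ ≤ 0 := fun x => by
      have := enorm_realize_le_tLp (finite_support_blockC c p u) x
      rw [h1, nonpos_iff_eq_zero, enorm_eq_zero] at this
      rw [this, norm_zero]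
    have h3 := sum_sq_norm_coeff_le (finite_support_apply (finite_support_blockC c p u) i) le_rfl
      (norm_realize_apply_le (finite_support_blockC c p u) h2 i) {m}
    rw [Finset.sum_singleton] at h3
    have h4 : ‖blockC c p u m i‖ ^ 2 = 0 := le_antisymm (by simpa using h3) (sq_nonneg _)
    simpa using h4
  funext m
  refine (hasSum_blockC c u m).unique ?_
  have h0 : (fun p => blockC c p u m) = fun _ => 0 := funext fun p => funext fun i => hb p i m
  rw [h0]
  exact hasSum_zero

section Interactions

variable {c : Cutoff} {σ : ℝ} {u v : VC d} {X Y : ℕ → ℝ}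

lemma summable_and_hasSum_convC_blockC_apply (hσ : -1 ≤ σ)
    (hX : ∀ p x, ‖realize (blockC c p u) x‖ ≤ X p) (hY : ∀ q x, ‖realize (blockC c q v) x‖ ≤ Y q)
    (hXs : Summable fun p : ℕ => (2 : ℝ) ^ ((p : ℝ) * σ) * X p)
    (hYs : Summable fun q : ℕ => (2 : ℝ) ^ ((q : ℝ) * 1) * Y q) (k : Fin d → ℤ) (a b : Fin d) :
    (Summable fun m => u m a * v (k - m) b) ∧
      HasSum (fun pq : ℕ × ℕ => convC (fun m => blockC c pq.1 u m a)
        (fun m => blockC c pq.2 v m b) k) (convC (fun m => u m a) (fun m => v m b) k) :=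
  summable_and_hasSum_convC_blockC hσ
    (fun p => norm_realize_apply_le (finite_support_blockC c p u) (hX p) a)
    (fun q => norm_realize_apply_le (finite_support_blockC c q v) (hY q) b) hXs hYs k

lemma hasSum_realize_blockC_presForm (hσ : -1 ≤ σ)
    (hX : ∀ p x, ‖realize (blockC c p u) x‖ ≤ X p) (hY : ∀ q x, ‖realize (blockC c q v) x‖ ≤ Y q)
    (hXs : Summable fun p : ℕ => (2 : ℝ) ^ ((p : ℝ) * σ) * X p)
    (hYs : Summable fun q : ℕ => (2 : ℝ) ^ ((q : ℝ) * 1) * Y q) (j : ℕ) (x : Fin d → ℝ) :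
    HasSum (fun pq : ℕ × ℕ =>
        realize (blockC c j (presForm (blockC c pq.1 u) (blockC c pq.2 v))) x)
      (realize (blockC c j (presForm u v)) x) := by
  have h1 : ∀ k, HasSum (fun pq : ℕ × ℕ => presForm (blockC c pq.1 u) (blockC c pq.2 v) k)
      (presForm u v k) := fun k => Pi.hasSum.mpr fun i => by
    unfold presForm
    exact (hasSum_sum fun a _ => hasSum_sum fun b _ =>
      (summable_and_hasSum_convC_blockC_apply hσ hX hY hXs hYs k a b).2.mul_left _).mul_left _
  have h2 : ∀ (w : VC d), ∀ k ∉ (finite_znorm_lt (d := d) (2 ^ j)).toFinset,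
      blockC c j w k = 0 := fun w k hk => by
    by_contra h
    exact hk ((finite_znorm_lt (d := d) (2 ^ j)).mem_toFinset.mpr
      (lt_of_lpSymb_ne_zero (lpSymb_ne_zero_of_blockC_ne_zero h)))
  simp only [realize_eq_sum (h2 _)]
  exact hasSum_sum fun k _ => ((h1 k).const_smul _).const_smul _

lemma exists_of_blockC_presForm_ne_zero {j p q : ℕ} {k : Fin d → ℤ}
    (h : blockC c j (presForm (blockC c p u) (blockC c q v)) k ≠ 0) :
    ∃ m n : Fin d → ℤ, lpSymb c p (znorm m) ≠ 0 ∧ lpSymb c q (znorm n) ≠ 0 ∧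
      lpSymb c j (znorm (m + n)) ≠ 0 := by
  have hj := lpSymb_ne_zero_of_blockC_ne_zero h
  have hab : ∃ a b, convC (fun m => blockC c p u m a) (fun m => blockC c q v m b) k ≠ 0 := by
    contrapose! h
    funext i
    simp only [blockC_apply, Pi.zero_apply]
    rw [blockC]
    simp [presForm, h]
  obtain ⟨a, b, hab⟩ := hab
  obtain ⟨m, hm, hn⟩ := exists_ne_zero_of_convC_ne_zero hab
  refine ⟨m, k - m, lpSymb_ne_zero_of_blockC_ne_zero fun h0 => hm (congrFun h0 a),
    lpSymb_ne_zero_of_blockC_ne_zero fun h0 => hn (congrFun h0 b), ?_⟩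
  rwa [add_sub_cancel]

lemma weighted_block_presForm_le (hσ₁ : -1 < σ) (hσ₂ : σ ≤ 1) {C : ℝ} (hC : 0 ≤ C) {j p q : ℕ}
    {A B : ℝ} (hA : 0 ≤ A) (hB : 0 ≤ B) {x : Fin d → ℝ}
    (h : ‖realize (blockC c j (presForm (blockC c p u) (blockC c q v))) x‖ ≤
      C * min (2 ^ j) (2 ^ p * 2 ^ q / 2 ^ j) * (A * B)) :
    (2 : ℝ) ^ ((j : ℝ) * σ) *
        ‖realize (blockC c j (presForm (blockC c p u) (blockC c q v))) x‖ ≤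
      C * 2 ^ (27 : ℝ) * (diagWeight σ (j - p) + diagWeight σ (j - q)) *
        (((2 : ℝ) ^ ((p : ℝ) * σ) * A) * ((2 : ℝ) ^ ((q : ℝ) * 1) * B)) := by
  by_cases h0 : ∃ k, blockC c j (presForm (blockC c p u) (blockC c q v)) k ≠ 0
  · obtain ⟨k, hk⟩ := h0
    obtain ⟨m, n, hp, hq, hj⟩ := exists_of_blockC_presForm_ne_zero hk
    calc _ ≤ (2 : ℝ) ^ ((j : ℝ) * σ) * (C * min (2 ^ j) (2 ^ p * 2 ^ q / 2 ^ j) * (A * B)) := by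
          gcongr
      _ = C * ((2 : ℝ) ^ ((j : ℝ) * σ) * min (2 ^ j) (2 ^ p * 2 ^ q / 2 ^ j)) * (A * B) := by
          ring
      _ ≤ C * (2 ^ (27 : ℝ) * (diagWeight σ (j - p) + diagWeight σ (j - q)) *
            ((2 : ℝ) ^ ((p : ℝ) * σ) * (2 : ℝ) ^ ((q : ℝ) * 1))) * (A * B) := by
          exact mul_le_mul_of_nonneg_right (mul_le_mul_of_nonneg_left
            (interaction_bound hσ₁ hσ₂ hp hq hj) hC) (mul_nonneg hA hB)
      _ = _ := by ring
  · push Not at h0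
    have hr : realize (blockC c j (presForm (blockC c p u) (blockC c q v))) x = 0 := by
      simp [realize, h0]
    rw [hr, norm_zero, mul_zero]
    have h1 := diagWeight_nonneg σ (j - p)
    have h2 := diagWeight_nonneg σ (j - q)
    positivity

end Interactions

lemma tsum_tsum_diagWeight_le (σ : ℝ) (K : ℝ≥0∞) (A B : ℕ → ℝ≥0∞) :
    ∑' j : ℕ, ∑' pq : ℕ × ℕ, K * (ENNReal.ofReal (diagWeight σ (j - pq.1)) +
        ENNReal.ofReal (diagWeight σ (j - pq.2))) * (A pq.1 * B pq.2) ≤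
      K * (2 * ∑' z, ENNReal.ofReal (diagWeight σ z)) * ((∑' p, A p) * ∑' q, B q) := by
  have h1 : ∀ l : ℕ, ∑' j : ℕ, ENNReal.ofReal (diagWeight σ (j - l)) ≤
      ∑' z, ENNReal.ofReal (diagWeight σ z) := fun l =>
    ENNReal.tsum_comp_le_tsum_of_injective (f := fun j : ℕ => (j : ℤ) - l)
      (fun i j h => by simpa using h) fun z => ENNReal.ofReal (diagWeight σ z)
  have h2 : (∑' p, A p) * ∑' q, B q = ∑' pq : ℕ × ℕ, A pq.1 * B pq.2 := by
    rw [ENNReal.tsum_prod (f := fun p q => A p * B q)]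
    simp only [ENNReal.tsum_mul_left, ENNReal.tsum_mul_right]
  rw [ENNReal.tsum_comm, h2, ← ENNReal.tsum_mul_left]
  refine ENNReal.tsum_le_tsum fun pq => ?_
  rw [ENNReal.tsum_mul_right, ENNReal.tsum_mul_left, ENNReal.tsum_add, two_mul]
  gcongr <;> exact h1 _

/-- The bilinear pressure estimate for fields with finite Besov norms. -/
lemma exists_besov_presForm_bound (d : ℕ) (c : Cutoff) {σ : ℝ} (hσ₁ : -1 < σ) (hσ₂ : σ ≤ 1) :
    ∃ C : ℝ≥0, ∀ u v : VC d, DivFree u → DivFree v → besov c σ ∞ 1 u ≠ ∞ →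
      besov c 1 ∞ 1 v ≠ ∞ → (∀ k a b, Summable fun m => u m a * v (k - m) b) ∧
        besov c σ ∞ 1 (presForm u v) ≤ C * (besov c σ ∞ 1 u * besov c 1 ∞ 1 v) := by
  obtain ⟨C, hC, hbd⟩ := exists_block_presForm_bound d c
  have hG := (summable_diagWeight hσ₁).tsum_ofReal_ne_top
  have hK : ENNReal.ofReal (C * 2 ^ (27 : ℝ)) * (2 * ∑' z, ENNReal.ofReal (diagWeight σ z)) ≠ ∞ :=
    ENNReal.mul_ne_top ENNReal.ofReal_ne_top (ENNReal.mul_ne_top ENNReal.ofNat_ne_top hG)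
  refine ⟨(ENNReal.ofReal (C * 2 ^ (27 : ℝ)) *
    (2 * ∑' z, ENNReal.ofReal (diagWeight σ z))).toNNReal, fun u v hu hv hun hvn => ?_⟩
  obtain ⟨X, hX, hXs, hXe⟩ := exists_block_bound_of_besov_ne_top hun
  obtain ⟨Y, hY, hYs, hYe⟩ := exists_block_bound_of_besov_ne_top hvn
  refine ⟨fun k a b =>
    (summable_and_hasSum_convC_blockC_apply hσ₁.le hX hY hXs hYs k a b).1, ?_⟩
  rw [ENNReal.coe_toNNReal hK, ← hXe, ← hYe, besov_one_eq]
  refine le_trans (ENNReal.tsum_le_tsum fun j => ?_) (tsum_tsum_diagWeight_le σ _ _ _)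
  have hw0 : (2 : ℝ≥0∞) ^ ((j : ℝ) * σ) ≠ 0 := by
    rw [two_rpow_eq_ofReal]
    exact (ENNReal.ofReal_pos.mpr (by positivity)).ne'
  have hwt : (2 : ℝ≥0∞) ^ ((j : ℝ) * σ) ≠ ∞ := by
    rw [two_rpow_eq_ofReal]
    exact ENNReal.ofReal_ne_top
  refine ENNReal.mul_le_of_le_div' (tLp_top_le fun x => ?_)
  rw [ENNReal.le_div_iff_mul_le (Or.inl hw0) (Or.inl hwt), mul_comm,
    ← (hasSum_realize_blockC_presForm hσ₁.le hX hY hXs hYs j x).tsum_eq]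
  refine (mul_le_mul_right enorm_tsum_le_tsum_enorm _).trans ?_
  rw [← ENNReal.tsum_mul_left]
  refine ENNReal.tsum_le_tsum fun ⟨p, q⟩ => ?_
  have hX0 : 0 ≤ X p := (norm_nonneg _).trans (hX p 0)
  have hY0 : 0 ≤ Y q := (norm_nonneg _).trans (hY q 0)
  have h1 := diagWeight_nonneg σ (j - p)
  have h2 := diagWeight_nonneg σ (j - q)
  have hfreq : ∀ (w : VC d) (l : ℕ) (m : Fin d → ℤ), blockC c l w m ≠ 0 → znorm m < 2 ^ l :=
    fun w l m hm => lt_of_lpSymb_ne_zero (lpSymb_ne_zero_of_blockC_ne_zero hm)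
  have key := weighted_block_presForm_le hσ₁ hσ₂ hC hX0 hY0 (hbd j p q _ _ (hu.blockC c p)
    (hv.blockC c q) (hfreq u p) (hfreq v q) _ _ (hX p) (hY q) x)
  rw [two_rpow_eq_ofReal, ← ofReal_norm, ← ENNReal.ofReal_mul (by positivity),
    ← ENNReal.ofReal_add h1 h2, ← ENNReal.ofReal_mul (by positivity),
    ← ENNReal.ofReal_mul (by positivity), ← ENNReal.ofReal_mul (by positivity)]
  exact ENNReal.ofReal_le_ofReal key

lemma pressure_zero_left (v : VC d) : gradC (invNegLap (divC (advect 0 v))) = 0 := by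
  funext k i
  simp [gradC, invNegLap, divC, advect]

lemma pressure_zero_right (u : VC d) : gradC (invNegLap (divC (advect u 0))) = 0 := by
  funext k i
  simp [gradC, invNegLap, divC, advect]

lemma besov_pressure_le_of_ne_top {c : Cutoff} {σ s t : ℝ} {C : ℝ≥0∞} (hC : C ≠ 0) {u v : VC d}
    (h : besov c s ∞ 1 u ≠ ∞ → besov c t ∞ 1 v ≠ ∞ →
      besov c σ ∞ 1 (gradC (invNegLap (divC (advect u v)))) ≤
        C * (besov c s ∞ 1 u * besov c t ∞ 1 v)) :
    besov c σ ∞ 1 (gradC (invNegLap (divC (advect u v)))) ≤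
      C * (besov c s ∞ 1 u * besov c t ∞ 1 v) := by
  by_cases hu : besov c s ∞ 1 u = 0
  · rw [eq_zero_of_besov_eq_zero hu, pressure_zero_left, besov_zero]
    exact zero_le
  by_cases hv : besov c t ∞ 1 v = 0
  · rw [eq_zero_of_besov_eq_zero hv, pressure_zero_right, besov_zero]
    exact zero_le
  by_cases hu' : besov c s ∞ 1 u = ∞
  · rw [hu', ENNReal.top_mul hv, ENNReal.mul_top hC]
    exact le_top
  by_cases hv' : besov c t ∞ 1 v = ∞
  · rw [hv', ENNReal.mul_top hu, ENNReal.mul_top hC]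
    exact le_top
  exact h hu' hv'

/-- **Pressure estimate.**  For any `−1 < σ ≤ 1` there is a constant `C` such that
if `u` and `v` are divergence-free vector fields on `𝕋^d`, then
`‖∇(−Δ)^{−1} div(u·∇v)‖_{B^σ_{∞,1}} ≤ C min(‖u‖_{B^σ_{∞,1}}‖v‖_{B^1_{∞,1}}, ‖u‖_{B^1_{∞,1}}‖v‖_{B^σ_{∞,1}})`. -/
theorem pressure_estimate (d : ℕ) (c : Cutoff) (σ : ℝ) (hσ₁ : -1 < σ) (hσ₂ : σ ≤ 1) :
    ∃ C : ℝ≥0, 0 < C ∧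
      ∀ u v : VC d, DivFree u → DivFree v →
        besov c σ ∞ 1 (gradC (invNegLap (divC (advect u v)))) ≤
          (C : ℝ≥0∞) * min (besov c σ ∞ 1 u * besov c 1 ∞ 1 v)
            (besov c 1 ∞ 1 u * besov c σ ∞ 1 v) := by
  obtain ⟨C, hC⟩ := exists_besov_presForm_bound d c hσ₁ hσ₂
  have hpos : ((C + 1 : ℝ≥0) : ℝ≥0∞) ≠ 0 := by simp
  have hle : (C : ℝ≥0∞) ≤ (C + 1 : ℝ≥0) := by exact_mod_cast le_self_add
  refine ⟨C + 1, by positivity, fun u v hu hv => ?_⟩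
  rw [mul_min]
  refine le_min (besov_pressure_le_of_ne_top hpos fun hun hvn => ?_)
    (besov_pressure_le_of_ne_top hpos fun hun hvn => ?_)
  · obtain ⟨hs, h⟩ := hC u v hu hv hun hvn
    rw [pressure_eq_presForm hu hs]
    exact h.trans (by gcongr)
  · obtain ⟨hs, h⟩ := hC v u hv hu hvn hun
    rw [pressure_eq_presForm hu fun k a b => ?_, presForm_comm,
      mul_comm (besov c 1 ∞ 1 u)]
    · exact h.trans (by gcongr)
    · refine ((Equiv.subLeft k).summable_iff.mp ?_)
      refine (hs k b a).congr fun m => ?_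
      simp [mul_comm]

end
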